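/- arXiv:1101.3074 — 2 statements merged into one kernel-verified Lean document; each statement's English description precedes it below -/
import Mathlib

section
/- Let 0 < ε ≤ 1, 0 < μ ≤ 1 and C > 0 be constants. There exist constants r₀ and c (depending only on C, ε and μ) such that the following holds for all sufficiently large n. Let A be an n×n real matrix with ρ_b^{(μ)}(A) ≥ n^{−C}. Then there exist index sets I₀, J₀ with |I₀|, |J₀| ≤ r₀, index sets I, J with |I|, |J| ≥ n − 3n^ε, I ∩ I₀ = ∅ and J ∩ J₀ = ∅, a nonzero integer k and integers k_{i i₀} (i ∈ I, i₀ ∈ I₀), a nonzero integer l and integers l_{j₀ j} (j ∈ J, j₀ ∈ J₀), all of absolute value at most n^c, with the following property. Define n×n matrices L and R by: for i ∈ I, L(i,i) = k and L(i,i₀) = k_{i i₀} for i₀ ∈ I₀; for i ∉ I, L(i,i) = 1; all other entries of L are 0; for j ∈ J, R(j,j) = l and R(j₀,j) = l_{j₀ j} for j₀ ∈ J₀; for j ∉ J, R(j,j) = 1; all other entries of R are 0. Then the matrix A' = L·A·R satisfies: for each i ∈ I, all but at most n^ε of the entries of the i-th row of A' belong to a proper symmetric GAP Q_i of rank at most r₀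 and size at most n^c; and for each j ∈ J, all but at most n^ε of the entries of the j-th column of A' belong to a proper symmetric GAP P_j of rank at most r₀ and size at most n^c. -/
open scoped Classical BigOperators

noncomputable section

/-- `Q` is a proper symmetric generalized arithmetic progression (GAP) of rank at most `r`
and size at most `s`. -/
def IsProperSymGAPSet (Q : Set ℝ) (r : ℕ) (s : ℝ) : Prop :=
  ∃ (r' : ℕ) (g : Fin r' → ℝ) (N : Fin r' → ℕ),
    r' ≤ r ∧
    Q = {x : ℝ | ∃ m : Fin r' → ℤ, (∀ i, |m i| ≤ (N i : ℤ)) ∧ x = ∑ i, (m i : ℝ) * g i} ∧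
    (∀ m m' : Fin r' → ℤ, (∀ i, |m i| ≤ (N i : ℤ)) → (∀ i, |m' i| ≤ (N i : ℤ)) →
      (∑ i, (m i : ℝ) * g i) = (∑ i, (m' i : ℝ) * g i) → m = m') ∧
    (∏ i, (2 * (N i : ℝ) + 1)) ≤ s

/-- The three possible values of the lazy sign `η^μ`: `+1`, `-1`, `0`. -/
def etaV : Fin 3 → ℝ := ![1, -1, 0]

/-- The corresponding probability weights: `μ/2`, `μ/2`, `1 - μ`. -/
def etaW (μ : ℝ) : Fin 3 → ℝ := ![μ / 2, μ / 2, 1 - μ]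

/-- Probability of an event for a family of iid copies of `η^μ`, indexed by a finite
type. -/
def probEta (μ : ℝ) {ι : Type} [Fintype ι] (E : (ι → ℝ) → Prop) : ℝ :=
  ∑ s : ι → Fin 3, (∏ i, etaW μ (s i)) * (if E fun i => etaV (s i) then 1 else 0)

/-- The weighted bilinear concentration probability
`ρ_b^{(μ)}(A) = sup_a P(Σ a_{ij} x_i y_j = a)`. -/
def rhoBmu (μ : ℝ) (n : ℕ) (A : Matrix (Fin n) (Fin n) ℝ) : ℝ :=
  ⨆ a : ℝ, probEta μ (fun xy : (Fin n ⊕ Fin n) → ℝ =>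
    ∑ i, ∑ j, A i j * xy (Sum.inl i) * xy (Sum.inr j) = a)

lemma abs_sum_cos_le (φ : ℝ) (hφ : Complex.exp (φ * Complex.I) ≠ 1) (N : ℕ) :
    |∑ j ∈ Finset.range N, Real.cos (φ * j)| ≤ 2 / ‖Complex.exp (φ * Complex.I) - 1‖ := by
  have hre : ∑ j ∈ Finset.range N, Real.cos (φ * j)
      = (∑ j ∈ Finset.range N, Complex.exp (φ * Complex.I) ^ j).re := by
    rw [Complex.re_sum]
    refine Finset.sum_congr rfl fun j _ => ?_
    rw [← Complex.exp_nat_mul, ← Complex.exp_ofReal_mul_I_re]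
    congr 2
    push_cast
    ring
  rw [hre, geom_sum_eq hφ]
  refine (Complex.abs_re_le_norm _).trans ?_
  rw [norm_div]
  gcongr
  refine (norm_sub_le _ _).trans ?_
  rw [norm_pow, Complex.norm_exp_ofReal_mul_I]
  norm_num

/-- Averaging `cos (z ξ)` over a suitable finite arithmetic progression of frequencies `ξ`
nearly annihilates all nonzero `z` from a given finite set. -/
lemma exists_sum_cos_le (Z : Finset ℝ) {δ : ℝ} (hδ : 0 < δ) :
    ∃ (θ : ℝ) (N : ℕ), 0 < N ∧ ∀ z ∈ Z, z ≠ 0 →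
      |∑ j ∈ Finset.range N, Real.cos (z * (θ * j))| ≤ δ * N := by
  set M : ℝ := 1 + ∑ z ∈ Z, |z| with hM
  have hM0 : 0 < M := by positivity
  set K : ℝ := ∑ z ∈ Z, 2 / ‖Complex.exp ((z * M⁻¹ : ℝ) * Complex.I) - 1‖ with hK
  obtain ⟨N, hN⟩ := exists_nat_gt (K / δ)
  have hK0 : 0 ≤ K := Finset.sum_nonneg fun _ _ => by positivity
  have hNpos : (0 : ℝ) < N := lt_of_le_of_lt (by positivity) hN
  refine ⟨M⁻¹, N, by exact_mod_cast hNpos, fun z hz hz0 => ?_⟩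
  have hzM : |z * M⁻¹| < 1 := by
    rw [abs_mul, abs_of_pos (inv_pos.2 hM0), mul_inv_lt_iff₀ hM0, one_mul]
    have := Finset.single_le_sum (f := fun z : ℝ => |z|) (fun _ _ => abs_nonneg _) hz
    linarith
  have hne : Complex.exp ((z * M⁻¹ : ℝ) * Complex.I) ≠ 1 := by
    intro h
    have hcos : Real.cos (z * M⁻¹) = 1 := by
      rw [← Complex.exp_ofReal_mul_I_re, h, Complex.one_re]
    have hpi := Real.pi_gt_three
    have habs := abs_lt.1 hzM
    have := (Real.cos_eq_one_iff_of_lt_of_lt (by linarith) (by linarith)).1 hcos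
    exact (mul_ne_zero hz0 (inv_pos.2 hM0).ne') this
  have h1 := abs_sum_cos_le _ hne N
  have h2 : 2 / ‖Complex.exp ((z * M⁻¹ : ℝ) * Complex.I) - 1‖ ≤ K :=
    Finset.single_le_sum (f := fun z : ℝ => 2 / ‖Complex.exp ((z * M⁻¹ : ℝ) * Complex.I) - 1‖)
      (fun _ _ => by positivity) hz
  have h3 : K ≤ δ * N := by
    rw [div_lt_iff₀ hδ] at hN
    linarith
  simp only [← mul_assoc]
  exact (h1.trans h2).trans h3

/-- The probability that `n` independent copies of `η^μ` take the values indexed by `s`. -/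
def signWeight {n : ℕ} (μ : ℝ) (s : Fin n → Fin 3) : ℝ := ∏ i, etaW μ (s i)

lemma etaW_nonneg {μ : ℝ} (hμ0 : 0 < μ) (hμ1 : μ ≤ 1) (i : Fin 3) : 0 ≤ etaW μ i := by
  fin_cases i <;> simp [etaW] <;> linarith

lemma signWeight_nonneg {n : ℕ} {μ : ℝ} (hμ0 : 0 < μ) (hμ1 : μ ≤ 1) (s : Fin n → Fin 3) :
    0 ≤ signWeight μ s :=
  Finset.prod_nonneg fun _ _ => etaW_nonneg hμ0 hμ1 _

lemma sum_signWeight {n : ℕ} (μ : ℝ) : ∑ s : Fin n → Fin 3, signWeight μ s = 1 := by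
  unfold signWeight
  rw [← Fintype.piFinset_univ, ← Finset.prod_univ_sum]
  simp [etaW, Fin.sum_univ_three]

lemma abs_sum_signWeight_cos_le {n : ℕ} (μ : ℝ) (θ : Fin n → ℝ) (α : ℝ) :
    |∑ s : Fin n → Fin 3, signWeight μ s * Real.cos (∑ i, θ i * etaV (s i) - α)|
      ≤ ∏ i, |1 - μ + μ * Real.cos (θ i)| := by
  have hre : ∑ s : Fin n → Fin 3, signWeight μ s * Real.cos (∑ i, θ i * etaV (s i) - α)
      = (Complex.exp ((-α : ℝ) * Complex.I) *
          ∏ i, ∑ j : Fin 3, (etaW μ j : ℂ) * Complex.exp ((θ i * etaV j : ℝ) * Complex.I)).re := by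
    rw [Finset.prod_univ_sum, Fintype.piFinset_univ, Finset.mul_sum, Complex.re_sum]
    refine Finset.sum_congr rfl fun s _ => ?_
    rw [Finset.prod_mul_distrib, ← Complex.exp_sum, mul_left_comm, ← Complex.exp_add,
      ← Complex.exp_ofReal_mul_I_re, ← Complex.re_ofReal_mul, signWeight]
    congr 2
    · push_cast; rfl
    · congr 1
      push_cast
      rw [← Finset.sum_mul]
      ring
  rw [hre]
  refine (Complex.abs_re_le_norm _).trans ?_
  rw [norm_mul, Complex.norm_exp_ofReal_mul_I, one_mul, norm_prod]
  refine Finset.prod_le_prod (fun _ _ => norm_nonneg _) fun i _ => le_of_eq ?_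
  rw [← Real.norm_eq_abs, ← Complex.norm_real]
  congr 1
  simp only [Fin.sum_univ_three, etaW, etaV]
  simp [Complex.cos, Complex.exp_neg]
  ring

lemma abs_char_le {μ : ℝ} (hμ0 : 0 < μ) (hμ1 : μ ≤ 1) (θ : ℝ) :
    |1 - μ + μ * Real.cos θ| ≤ Real.exp (-(μ / 2) * Real.sin θ ^ 2) := by
  refine abs_le_of_sq_le_sq ?_ (Real.exp_pos _).le
  have h1 : (1 - μ + μ * Real.cos θ) ^ 2 ≤ 1 - μ * Real.sin θ ^ 2 := by
    rw [Real.sin_sq]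
    have h2 := Real.cos_le_one θ
    have h3 := Real.neg_one_le_cos θ
    nlinarith [mul_nonneg (mul_nonneg hμ0.le (sub_nonneg.2 hμ1)) (sq_nonneg (1 - Real.cos θ))]
  refine h1.trans ?_
  rw [← Real.exp_nat_mul]
  have := Real.add_one_le_exp (-(μ * Real.sin θ ^ 2))
  refine le_trans (by linarith) (this.trans (le_of_eq ?_))
  congr 1
  push_cast
  ring

lemma abs_sin_sum_le {ι : Type*} (S : Finset ι) (f : ι → ℝ) :
    |Real.sin (∑ i ∈ S, f i)| ≤ ∑ i ∈ S, |Real.sin (f i)| := by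
  induction S using Finset.induction_on with
  | empty => simp
  | insert i S hi ih =>
    rw [Finset.sum_insert hi, Finset.sum_insert hi, Real.sin_add]
    refine (abs_add_le _ _).trans (add_le_add ?_ (le_trans ?_ ih)) <;> rw [abs_mul]
    · exact mul_le_of_le_one_right (abs_nonneg _) (Real.abs_cos_le_one _)
    · exact mul_le_of_le_one_left (abs_nonneg _) (Real.abs_cos_le_one _)

lemma abs_sin_nat_mul_le (k : ℕ) (x : ℝ) : |Real.sin (k * x)| ≤ k * |Real.sin x| := by
  have := abs_sin_sum_le (Finset.range k) fun _ => x
  simpa using this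

/-- Weighted Cauchy-Schwarz for the sine of an integer combination. -/
lemma sin_sum_sq_le {n : ℕ} (c : Fin n → ℕ) (θ : Fin n → ℝ) :
    Real.sin (∑ i, c i * θ i) ^ 2 ≤ (∑ i, c i : ℕ) * ∑ i, c i * Real.sin (θ i) ^ 2 := by
  have h1 : |Real.sin (∑ i, c i * θ i)| ≤ ∑ i, c i * |Real.sin (θ i)| :=
    (abs_sin_sum_le _ _).trans (Finset.sum_le_sum fun i _ => abs_sin_nat_mul_le _ _)
  rw [← sq_abs]
  refine (pow_le_pow_left₀ (abs_nonneg _) h1 2).trans ?_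
  push_cast
  refine Finset.sum_sq_le_sum_mul_sum_of_sq_le_mul _ (fun _ _ => by positivity)
    (fun _ _ => by positivity) fun i _ => le_of_eq ?_
  rw [mul_pow, sq_abs]
  ring

/-- A large-sieve bound: few reals `y` can have `cos (2 y ξ)` large on average over a dense set
of frequencies. -/
lemma card_le_of_le_sum_cos {ρ θ : ℝ} (hρ : 0 < ρ) {N : ℕ} (hN : 0 < N) (S : Finset ℕ)
    (hSN : S ⊆ Finset.range N) (hS : ρ / 2 * N ≤ S.card) (Y : Finset ℝ)
    (hY : ∀ y ∈ Y, (S.card : ℝ) / 2 ≤ ∑ j ∈ S, Real.cos (2 * (y * (θ * j))))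
    (hsub : ∀ y ∈ Y, ∀ y' ∈ Y, 2 * (y - y') ≠ 0 →
      |∑ j ∈ Finset.range N, Real.cos (2 * (y - y') * (θ * j))| ≤ ρ / 16 * N)
    (hadd : ∀ y ∈ Y, ∀ y' ∈ Y, 2 * (y + y') ≠ 0 →
      |∑ j ∈ Finset.range N, Real.cos (2 * (y + y') * (θ * j))| ≤ ρ / 16 * N) :
    (Y.card : ℝ) ≤ 16 / ρ := by
  have hNpos : (0 : ℝ) < N := by exact_mod_cast hN
  have hδN : 0 ≤ ρ / 16 * N := by positivity
  set g : ℕ → ℝ := fun j => ∑ y ∈ Y, Real.cos (2 * (y * (θ * j))) with hg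
  have hlow : (Y.card : ℝ) * (S.card / 2) ≤ ∑ j ∈ S, g j := by
    rw [Finset.sum_comm, ← nsmul_eq_mul]
    exact Finset.card_nsmul_le_sum _ _ _ hY
  have hsq : (∑ j ∈ S, g j) ^ 2 ≤ S.card * ∑ j ∈ Finset.range N, g j ^ 2 := by
    refine (sq_sum_le_card_mul_sum_sq).trans ?_
    gcongr
  have hbound (y y' : ℝ) (hy : y ∈ Y) (hy' : y' ∈ Y) :
      ∑ j ∈ Finset.range N, Real.cos (2 * (y * (θ * j))) * Real.cos (2 * (y' * (θ * j)))
        ≤ (if y = y' then (N : ℝ) / 2 else 0) + (if y = -y' then (N : ℝ) / 2 else 0)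
          + ρ / 16 * N := by
    have h1 : ∑ j ∈ Finset.range N, Real.cos (2 * (y - y') * (θ * j))
        ≤ (if y = y' then (N : ℝ) else 0) + ρ / 16 * N := by
      split_ifs with h
      · simp [h, hδN]
      · rw [zero_add]
        exact (le_abs_self _).trans (hsub y hy y' hy'
          (mul_ne_zero two_ne_zero (sub_ne_zero.2 h)))
    have h2 : ∑ j ∈ Finset.range N, Real.cos (2 * (y + y') * (θ * j))
        ≤ (if y = -y' then (N : ℝ) else 0) + ρ / 16 * N := by
      split_ifs with h
      · simp [h, hδN]
      · rw [zero_add]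
        exact (le_abs_self _).trans (hadd y hy y' hy'
          (mul_ne_zero two_ne_zero fun h0 => h (eq_neg_of_add_eq_zero_left h0)))
    have h3 : ∑ j ∈ Finset.range N, Real.cos (2 * (y * (θ * j))) * Real.cos (2 * (y' * (θ * j)))
        = (∑ j ∈ Finset.range N, Real.cos (2 * (y - y') * (θ * j))
          + ∑ j ∈ Finset.range N, Real.cos (2 * (y + y') * (θ * j))) / 2 := by
      rw [← Finset.sum_add_distrib, Finset.sum_div]
      refine Finset.sum_congr rfl fun j _ => ?_
      rw [show 2 * (y - y') * (θ * j) = 2 * (y * (θ * j)) - 2 * (y' * (θ * j)) by ring,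
        show 2 * (y + y') * (θ * j) = 2 * (y * (θ * j)) + 2 * (y' * (θ * j)) by ring,
        Real.cos_sub, Real.cos_add]
      ring
    rw [h3]
    split_ifs at * <;> linarith
  have hg2 : ∑ j ∈ Finset.range N, g j ^ 2
      ≤ N * Y.card + ρ / 16 * N * (Y.card : ℝ) ^ 2 := by
    have h1 : ∑ j ∈ Finset.range N, g j ^ 2 = ∑ y ∈ Y, ∑ y' ∈ Y, ∑ j ∈ Finset.range N,
        Real.cos (2 * (y * (θ * j))) * Real.cos (2 * (y' * (θ * j))) := by
      simp only [hg, sq, Finset.sum_mul_sum]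
      rw [Finset.sum_comm]
      exact Finset.sum_congr rfl fun y _ => Finset.sum_comm
    rw [h1]
    have h2 : ∀ y ∈ Y, ∑ y' ∈ Y, ∑ j ∈ Finset.range N,
        Real.cos (2 * (y * (θ * j))) * Real.cos (2 * (y' * (θ * j)))
          ≤ N + ρ / 16 * N * Y.card := by
      intro y hy
      refine (Finset.sum_le_sum fun y' hy' => hbound y y' hy hy').trans ?_
      rw [Finset.sum_add_distrib, Finset.sum_add_distrib, Finset.sum_const, nsmul_eq_mul,
        Finset.sum_ite_eq]
      have h3 : ∑ y' ∈ Y, (if y = -y' then (N : ℝ) / 2 else 0) ≤ N / 2 := by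
        have hcomm (y' : ℝ) : y = -y' ↔ y' = -y := by constructor <;> intro h <;> linarith
        simp_rw [hcomm]
        rw [Finset.sum_ite_eq']
        split_ifs
        · exact le_rfl
        · positivity
      have h4 : (if y ∈ Y then (N : ℝ) / 2 else 0) ≤ N / 2 := by
        split_ifs
        exact le_rfl
      linarith
    refine (Finset.sum_le_sum h2).trans (le_of_eq ?_)
    rw [Finset.sum_const, nsmul_eq_mul]
    ring
  have hS0 : (0 : ℝ) < S.card := lt_of_lt_of_le (by positivity) hS
  rcases Nat.eq_zero_or_pos Y.card with h0 | h0
  · rw [h0]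
    simp only [Nat.cast_zero]
    positivity
  have hY0 : (0 : ℝ) < Y.card := by exact_mod_cast h0
  have hmain : ((Y.card : ℝ) * (S.card / 2)) ^ 2
      ≤ S.card * (N * Y.card + ρ / 16 * N * (Y.card : ℝ) ^ 2) :=
    (pow_le_pow_left₀ (by positivity) hlow 2).trans
      (hsq.trans (mul_le_mul_of_nonneg_left hg2 hS0.le))
  have h5 : (Y.card : ℝ) * S.card ≤ 4 * (N + ρ / 16 * N * Y.card) := by
    have : ((Y.card : ℝ) * S.card) * (Y.card * S.card)
        ≤ ((Y.card : ℝ) * S.card) * (4 * (N + ρ / 16 * N * Y.card)) := by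
      nlinarith [hmain]
    exact le_of_mul_le_mul_left this (by positivity)
  have h6 : (Y.card : ℝ) * (ρ / 2 * N) ≤ Y.card * S.card := mul_le_mul_of_nonneg_left hS hY0.le
  rw [le_div_iff₀ hρ]
  have h7 : (Y.card : ℝ) * ρ * N ≤ 16 * N := by nlinarith
  exact le_of_mul_le_mul_right h7 hNpos

/-- Large concentration of a linear form forces slow growth of the sums of its coefficients,
once few exceptional coefficients are discarded. -/
lemma exists_sums_card_le {n : ℕ} {μ ρ n' m a : ℝ} (hμ0 : 0 < μ) (hμ1 : μ ≤ 1) (v : Fin n → ℝ)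
    (hρ : 0 < ρ)
    (h : ρ ≤ ∑ s : Fin n → Fin 3, signWeight μ s *
      if ∑ i, v i * etaV (s i) = a then 1 else 0)
    (hm : Real.exp (-(μ / 2) * m) ≤ ρ / 4) (hm0 : 0 < m) (hn' : 0 < n') (l : ℕ)
    (hl : (l : ℝ) ^ 2 * m ≤ n' / 4) :
    ∃ E : Finset (Fin n), (E.card : ℝ) ≤ n' ∧ ∀ Y : Finset ℝ,
      (∀ y ∈ Y, ∃ c : Fin n → ℕ, (∀ i ∈ E, c i = 0) ∧ ∑ i, c i ≤ l ∧ y = ∑ i, c i * v i) →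
        (Y.card : ℝ) ≤ 16 / ρ := by
  set U : Finset ℝ := (Fintype.piFinset fun _ : Fin n => Finset.range (l + 1)).image
    fun c => ∑ i, (c i : ℝ) * v i with hU
  have hmemU {c : Fin n → ℕ} (hc : ∑ i, c i ≤ l) : ∑ i, (c i : ℝ) * v i ∈ U := by
    refine Finset.mem_image.2 ⟨c, Fintype.mem_piFinset.2 fun i => Finset.mem_range.2 ?_, rfl⟩
    have := Finset.single_le_sum (f := c) (fun _ _ => Nat.zero_le _) (Finset.mem_univ i)
    omega
  obtain ⟨θ, N, hN, hθ⟩ := exists_sum_cos_le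
    ((Finset.univ.image fun s : Fin n → Fin 3 => ∑ i, v i * etaV (s i) - a)
      ∪ ((U ×ˢ U).image fun p => 2 * (p.1 - p.2)) ∪ ((U ×ˢ U).image fun p => 2 * (p.1 + p.2)))
    (show 0 < ρ / 16 by positivity)
  have hN' : (0 : ℝ) < N := by exact_mod_cast hN
  set f : ℕ → ℝ := fun j => ∑ i, Real.sin (v i * (θ * j)) ^ 2 with hf
  set S : Finset ℕ := (Finset.range N).filter fun j => f j ≤ m with hS
  have hScard : ρ / 2 * N ≤ S.card := by
    have h1 : ρ * N ≤ ∑ s : Fin n → Fin 3, signWeight μ s *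
        (∑ j ∈ Finset.range N, Real.cos ((∑ i, v i * etaV (s i) - a) * (θ * j))
          + ρ / 16 * N) := by
      refine (mul_le_mul_of_nonneg_right h hN'.le).trans ?_
      rw [Finset.sum_mul]
      refine Finset.sum_le_sum fun s _ => ?_
      rw [mul_assoc]
      refine mul_le_mul_of_nonneg_left ?_ (signWeight_nonneg hμ0 hμ1 s)
      split_ifs with hs
      · simp only [hs, sub_self, zero_mul, Real.cos_zero, Finset.sum_const, Finset.card_range,
          nsmul_eq_mul]
        nlinarith
      · have := (abs_le.1 (hθ (∑ i, v i * etaV (s i) - a) (Finset.mem_union_left _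
          (Finset.mem_union_left _ (Finset.mem_image_of_mem _ (Finset.mem_univ s))))
          (sub_ne_zero.2 hs))).1
        linarith
    have h2 : ∑ s : Fin n → Fin 3, signWeight μ s *
        (∑ j ∈ Finset.range N, Real.cos ((∑ i, v i * etaV (s i) - a) * (θ * j))
          + ρ / 16 * N)
        = ∑ j ∈ Finset.range N, ∑ s : Fin n → Fin 3, signWeight μ s *
          Real.cos (∑ i, v i * (θ * j) * etaV (s i) - a * (θ * j)) + ρ / 16 * N := by
      simp only [mul_add]
      rw [Finset.sum_add_distrib, ← Finset.sum_mul, sum_signWeight, one_mul]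
      simp only [Finset.mul_sum]
      rw [Finset.sum_comm]
      congr 1
      refine Finset.sum_congr rfl fun j _ => Finset.sum_congr rfl fun s _ => ?_
      rw [sub_mul, Finset.sum_mul]
      congr 3
      exact Finset.sum_congr rfl fun i _ => by ring
    have h3 : ∀ j ∈ Finset.range N, ∑ s : Fin n → Fin 3, signWeight μ s *
          Real.cos (∑ i, v i * (θ * j) * etaV (s i) - a * (θ * j))
        ≤ (if f j ≤ m then 1 else 0) + ρ / 4 := by
      intro j _
      have h4 : ∑ s : Fin n → Fin 3, signWeight μ s *
          Real.cos (∑ i, v i * (θ * j) * etaV (s i) - a * (θ * j))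
          ≤ Real.exp (-(μ / 2) * f j) := by
        refine (le_abs_self _).trans ((abs_sum_signWeight_cos_le μ _ _).trans ?_)
        rw [hf, Finset.mul_sum, Real.exp_sum]
        exact Finset.prod_le_prod (fun _ _ => abs_nonneg _) fun i _ => abs_char_le hμ0 hμ1 _
      refine h4.trans ?_
      have hf0 : 0 ≤ f j := Finset.sum_nonneg fun _ _ => sq_nonneg _
      split_ifs with hj
      · have : Real.exp (-(μ / 2) * f j) ≤ 1 := Real.exp_le_one_iff.2 (by nlinarith)
        linarith
      · have : Real.exp (-(μ / 2) * f j) ≤ Real.exp (-(μ / 2) * m) :=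
          Real.exp_le_exp.2 (by nlinarith [not_le.1 hj])
        linarith
    have h5 := Finset.sum_le_sum h3
    rw [Finset.sum_add_distrib, Finset.sum_boole, Finset.sum_const, Finset.card_range,
      nsmul_eq_mul] at h5
    rw [h2] at h1
    change ρ / 2 * N ≤ (((Finset.range N).filter fun j => f j ≤ m).card : ℝ)
    nlinarith
  have hS0 : (0 : ℝ) < S.card := lt_of_lt_of_le (by positivity) hScard
  set e : Fin n → ℝ := fun i => ∑ j ∈ S, Real.sin (v i * (θ * j)) ^ 2 with he
  have hesum : ∑ i, e i ≤ S.card * m := by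
    rw [he, Finset.sum_comm, ← nsmul_eq_mul]
    exact Finset.sum_le_card_nsmul _ _ _ fun j hj => (Finset.mem_filter.1 hj).2
  have he0 (i : Fin n) : 0 ≤ e i := Finset.sum_nonneg fun _ _ => sq_nonneg _
  refine ⟨Finset.univ.filter fun i => m / n' * S.card < e i, ?_, fun Y hY => ?_⟩
  · set E := Finset.univ.filter fun i => m / n' * S.card < e i with hE
    have h1 : (E.card : ℝ) * (m / n' * S.card) ≤ S.card * m := by
      rw [← nsmul_eq_mul]
      refine (Finset.card_nsmul_le_sum E e _ fun i hi => (Finset.mem_filter.1 hi).2.le).trans ?_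
      exact (Finset.sum_le_sum_of_subset_of_nonneg (Finset.subset_univ _)
        fun i _ _ => he0 i).trans hesum
    have h2 : (E.card : ℝ) * (m / n' * S.card) = (E.card / n') * (S.card * m) := by ring
    rw [h2] at h1
    have h3 : (E.card : ℝ) / n' ≤ 1 := by
      by_contra hcon
      have := mul_lt_mul_of_pos_right (not_le.1 hcon) (mul_pos hS0 hm0)
      linarith
    rwa [div_le_one hn'] at h3
  · have hYU : ∀ y ∈ Y, y ∈ U := fun y hy => by
      obtain ⟨c, -, hc, rfl⟩ := hY y hy
      exact hmemU hc
    refine card_le_of_le_sum_cos (θ := θ) hρ hN S (Finset.filter_subset _ _) hScard Y ?_ ?_ ?_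
    · intro y hy
      obtain ⟨c, hcE, hc, rfl⟩ := hY y hy
      have h1 : ∑ j ∈ S, Real.sin ((∑ i, c i * v i) * (θ * j)) ^ 2
          ≤ (∑ i, c i : ℕ) * ∑ i, c i * e i := by
        have h2 : ∀ j ∈ S, Real.sin ((∑ i, c i * v i) * (θ * j)) ^ 2
            ≤ (∑ i, c i : ℕ) * ∑ i, c i * Real.sin (v i * (θ * j)) ^ 2 := by
          intro j _
          have := sin_sum_sq_le c fun i => v i * (θ * j)
          simpa only [Finset.sum_mul, mul_assoc] using this
        refine (Finset.sum_le_sum h2).trans (le_of_eq ?_)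
        rw [← Finset.mul_sum, Finset.sum_comm]
        simp only [he, Finset.mul_sum]
      have h3 : ∑ i, c i * e i ≤ (∑ i, c i : ℕ) * (m / n' * S.card) := by
        push_cast
        rw [Finset.sum_mul]
        refine Finset.sum_le_sum fun i _ => ?_
        by_cases hi : i ∈ Finset.univ.filter fun i => m / n' * S.card < e i
        · simp [hcE i hi]
        · have : e i ≤ m / n' * S.card := by simpa using hi
          gcongr
      have h4 : ((∑ i, c i : ℕ) : ℝ) ≤ l := by exact_mod_cast hc
      have h5 : ∑ j ∈ S, Real.sin ((∑ i, c i * v i) * (θ * j)) ^ 2 ≤ S.card / 4 := by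
        refine (h1.trans (mul_le_mul_of_nonneg_left h3 (by positivity))).trans ?_
        calc ((∑ i, c i : ℕ) : ℝ) * ((∑ i, c i : ℕ) * (m / n' * S.card))
            ≤ l * (l * (m / n' * S.card)) := by gcongr
          _ = (l ^ 2 * m) * (S.card / n') := by ring
          _ ≤ (n' / 4) * (S.card / n') := by gcongr
          _ = S.card / 4 := by field_simp
      have h6 : ∑ j ∈ S, Real.cos (2 * ((∑ i, c i * v i) * (θ * j)))
          = S.card - 2 * ∑ j ∈ S, Real.sin ((∑ i, c i * v i) * (θ * j)) ^ 2 := by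
        rw [Finset.mul_sum, ← nsmul_one (S.card), ← Finset.sum_const, ← Finset.sum_sub_distrib]
        refine Finset.sum_congr rfl fun j _ => ?_
        rw [Real.cos_two_mul, Real.cos_sq']
        ring
      linarith
    · intro y hy y' hy'
      exact hθ _ (Finset.mem_union_left _ (Finset.mem_union_right _ (Finset.mem_image.2
        ⟨(y, y'), Finset.mem_product.2 ⟨hYU y hy, hYU y' hy'⟩, rfl⟩)))
    · intro y hy y' hy'
      exact hθ _ (Finset.mem_union_right _ (Finset.mem_image.2
        ⟨(y, y'), Finset.mem_product.2 ⟨hYU y hy, hYU y' hy'⟩, rfl⟩))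

/-- A chain of generators `v (u 0), …, v (u (T - 1))` avoiding `E`, in which `m t ≤ q` is the
least positive multiple of `v (u t)` that is a combination of the previous generators with
coefficients smaller than their orders, or `m t = q` if there is no smaller one. -/
structure IsGeneratorChain {n : ℕ} (v : Fin n → ℝ) (E : Finset (Fin n)) (q T : ℕ)
    (u : ℕ → Fin n) (m : ℕ → ℕ) : Prop where
  notMem : ∀ t < T, u t ∉ E
  two_le : ∀ t < T, 2 ≤ m t
  le : ∀ t < T, m t ≤ q
  minimal : ∀ t < T, ∀ c : ℕ → ℤ, (∀ s < t, |c s| < m s) → ∀ j : ℕ, 0 < j → j < m t →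
    (j : ℝ) * v (u t) ≠ ∑ s ∈ Finset.range t, (c s : ℝ) * v (u s)
  relation : ∀ t < T, m t = q ∨ ∃ c : ℕ → ℤ, (∀ s < t, |c s| < m s) ∧
    (m t : ℝ) * v (u t) = ∑ s ∈ Finset.range t, (c s : ℝ) * v (u s)

namespace IsGeneratorChain

variable {n : ℕ} {v : Fin n → ℝ} {E : Finset (Fin n)} {q T : ℕ} {u : ℕ → Fin n} {m : ℕ → ℕ}

lemma eq_of_sum_eq (h : IsGeneratorChain v E q T u m) {a b : ℕ → ℕ} (ha : ∀ t < T, a t < m t)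
    (hb : ∀ t < T, b t < m t) {t : ℕ} (ht : t ≤ T)
    (hab : ∑ s ∈ Finset.range t, (a s : ℝ) * v (u s) = ∑ s ∈ Finset.range t, (b s : ℝ) * v (u s)) :
    ∀ s < t, a s = b s := by
  induction t with
  | zero => intro s hs; omega
  | succ t ih =>
    rw [Finset.sum_range_succ, Finset.sum_range_succ] at hab
    have key {a b : ℕ → ℕ} (ha : ∀ t < T, a t < m t) (hb : ∀ t < T, b t < m t)
        (hab : ∑ s ∈ Finset.range t, (a s : ℝ) * v (u s) + a t * v (u t)
          = ∑ s ∈ Finset.range t, (b s : ℝ) * v (u s) + b t * v (u t)) : ¬ a t < b t := by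
      intro hlt
      refine h.minimal t (by omega) (fun s => (a s : ℤ) - b s) (fun s hs => ?_) (b t - a t)
        (by omega) (lt_of_le_of_lt (Nat.sub_le _ _) (hb t (by omega))) ?_
      · have h1 := ha s (by omega)
        have h2 := hb s (by omega)
        rw [abs_lt]
        constructor <;> omega
      · rw [Nat.cast_sub hlt.le]
        push_cast
        simp only [sub_mul, Finset.sum_sub_distrib]
        linarith
    have hat : a t = b t := le_antisymm (not_lt.1 (key hb ha hab.symm)) (not_lt.1 (key ha hb hab))
    rw [hat] at hab
    intro s hs
    rcases Nat.lt_succ_iff_lt_or_eq.1 hs with hs | rfl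
    · exact ih (by omega) (add_right_cancel hab) s hs
    · exact hat

lemma prod_le (h : IsGeneratorChain v E q T u m) {l : ℕ} {B : ℝ} (hT : T * q ≤ l)
    (hB : ∀ Y : Finset ℝ, (∀ y ∈ Y, ∃ c : Fin n → ℕ, (∀ i ∈ E, c i = 0) ∧ ∑ i, c i ≤ l ∧
      y = ∑ i, c i * v i) → (Y.card : ℝ) ≤ B) :
    ((∏ t ∈ Finset.range T, m t : ℕ) : ℝ) ≤ B := by
  set P : Finset (Fin T → ℕ) := Fintype.piFinset fun t : Fin T => Finset.range (m t) with hP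
  have hcard : P.card = ∏ t ∈ Finset.range T, m t := by
    rw [hP, Fintype.card_piFinset, Finset.prod_range]
    simp
  set F : (Fin T → ℕ) → ℝ := fun a => ∑ t : Fin T, (a t : ℝ) * v (u t) with hF
  have hinj : Set.InjOn F P := by
    intro a ha b hb hab
    have ha' := Fintype.mem_piFinset.1 (Finset.mem_coe.1 ha)
    have hb' := Fintype.mem_piFinset.1 (Finset.mem_coe.1 hb)
    set a' : ℕ → ℕ := fun t => if h : t < T then a ⟨t, h⟩ else 0 with haa
    set b' : ℕ → ℕ := fun t => if h : t < T then b ⟨t, h⟩ else 0 with hbb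
    have := h.eq_of_sum_eq (a := a') (b := b')
      (fun t ht => by simpa [haa, ht] using ha' ⟨t, ht⟩)
      (fun t ht => by simpa [hbb, ht] using hb' ⟨t, ht⟩) le_rfl
      (by simpa [Finset.sum_range, haa, hbb] using hab)
    funext t
    simpa [haa, hbb] using this t t.2
  rw [← hcard, ← Finset.card_image_of_injOn hinj]
  refine hB _ fun y hy => ?_
  obtain ⟨a, ha, rfl⟩ := Finset.mem_image.1 hy
  have ha' := fun t => Finset.mem_range.1 (Fintype.mem_piFinset.1 ha t)
  refine ⟨fun i => ∑ t : Fin T, if u t = i then a t else 0, fun i hi => ?_, ?_, ?_⟩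
  · refine Finset.sum_eq_zero fun t _ => if_neg ?_
    rintro rfl
    exact h.notMem t t.2 hi
  · rw [Finset.sum_comm]
    simp only [Finset.sum_ite_eq, Finset.mem_univ, if_true]
    refine le_trans (Finset.sum_le_card_nsmul _ _ q fun t _ =>
      (ha' t).le.trans (h.le t t.2)) ?_
    simpa using hT
  · push_cast
    simp only [Finset.sum_mul, hF]
    rw [Finset.sum_comm]
    refine Finset.sum_congr rfl fun t _ => ?_
    simp

/-- Multiplying by the product of the orders eliminates the generators with a relation. -/
lemma exists_eq_sum_free (h : IsGeneratorChain v E q T u m) {t : ℕ} (ht : t ≤ T) (c : ℕ → ℤ)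
    (hc : ∀ s < t, |c s| < m s) :
    ∃ b : ℕ → ℤ, (∀ s, |b s| ≤ (∏ s ∈ Finset.range t, m s : ℕ) * q * 2 ^ t) ∧
      ((∏ s ∈ Finset.range t, m s : ℕ) : ℝ) * ∑ s ∈ Finset.range t, (c s : ℝ) * v (u s)
        = ∑ s ∈ (Finset.range T).filter (fun s => m s = q), (b s : ℝ) * v (u s) := by
  induction t generalizing c with
  | zero => exact ⟨0, by simp, by simp⟩
  | succ t ih =>
    obtain ⟨b, hb, hbe⟩ := ih (by omega) c fun s hs => hc s (by omega)
    set D : ℕ := ∏ s ∈ Finset.range t, m s with hD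
    have hD' : ∏ s ∈ Finset.range (t + 1), m s = D * m t := Finset.prod_range_succ _ _
    have hct := hc t (by omega)
    have hmt : (m t : ℤ) ≤ q := by exact_mod_cast h.le t (by omega)
    have hmt0 : (0 : ℤ) ≤ m t := by positivity
    obtain ⟨b', hb', hbe'⟩ : ∃ b' : ℕ → ℤ, (∀ s, |b' s| ≤ D * m t * q * 2 ^ t) ∧
        ((D * m t : ℕ) : ℝ) * ((c t : ℝ) * v (u t))
          = ∑ s ∈ (Finset.range T).filter (fun s => m s = q), (b' s : ℝ) * v (u s) := by
      rcases h.relation t (by omega) with hq | ⟨c', hc', hrel⟩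
      · refine ⟨fun s => if s = t then D * m t * c t else 0, fun s => ?_, ?_⟩
        · beta_reduce
          split_ifs
          · rw [abs_mul, abs_of_nonneg (by positivity)]
            calc (D * m t : ℤ) * |c t| ≤ D * m t * q := by gcongr; omega
              _ ≤ D * m t * q * 2 ^ t := le_mul_of_one_le_right (by positivity)
                  (one_le_pow₀ (by norm_num))
          · rw [abs_zero]
            positivity
        · rw [Finset.sum_eq_single t]
          · simp only [if_true]
            push_cast
            ring
          · intro s _ hs
            simp [hs]
          · intro hs
            exact (hs (Finset.mem_filter.2 ⟨Finset.mem_range.2 (by omega), hq⟩)).elim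
      · obtain ⟨b'', hb'', hbe''⟩ := ih (by omega) c' hc'
        refine ⟨fun s => c t * b'' s, fun s => ?_, ?_⟩
        · rw [abs_mul]
          calc |c t| * |b'' s| ≤ m t * (D * q * 2 ^ t) := by gcongr; exact hb'' s
            _ = D * m t * q * 2 ^ t := by ring
        · push_cast
          simp only [mul_assoc]
          rw [← Finset.mul_sum, ← hbe'', ← hrel]
          ring
    refine ⟨fun s => m t * b s + b' s, fun s => ?_, ?_⟩
    · rw [hD']
      refine (abs_add_le _ _).trans ?_
      rw [abs_mul, abs_of_nonneg hmt0]
      have := mul_le_mul_of_nonneg_left (hb s) hmt0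
      have := hb' s
      push_cast
      rw [pow_succ]
      linarith
    · rw [hD', Finset.sum_range_succ, mul_add, hbe']
      push_cast
      simp only [add_mul, Finset.sum_add_distrib, mul_assoc]
      rw [← Finset.mul_sum, ← hbe]
      ring

/-- A chain is either extendable or its box of combinations contains every `v i` with
`i ∉ E`. -/
lemma exists_succ (h : IsGeneratorChain v E q T u m) (hq : 2 ≤ q) {i : Fin n} (hi : i ∉ E)
    (hspan : ∀ c : ℕ → ℤ, (∀ s < T, |c s| < m s) →
      v i ≠ ∑ s ∈ Finset.range T, (c s : ℝ) * v (u s)) :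
    ∃ u' m', IsGeneratorChain v E q (T + 1) u' m' := by
  let p : ℕ → Prop := fun j => 0 < j ∧ (j = q ∨ ∃ c : ℕ → ℤ, (∀ s < T, |c s| < m s) ∧
    (j : ℝ) * v i = ∑ s ∈ Finset.range T, (c s : ℝ) * v (u s))
  have hp : ∃ j, p j := ⟨q, by omega, Or.inl rfl⟩
  obtain ⟨hk0, hk⟩ := Nat.find_spec hp
  have hkq : Nat.find hp ≤ q := Nat.find_min' hp ⟨by omega, Or.inl rfl⟩
  have hmin : ∀ j < Nat.find hp, ¬ p j := fun j hj => Nat.find_min hp hj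
  set k := Nat.find hp with hkdef
  have hk2 : 2 ≤ k := by
    by_contra hlt
    have hk1 : k = 1 := by omega
    rcases hk with hk | ⟨c, hc, hce⟩
    · omega
    · rw [hk1, Nat.cast_one, one_mul] at hce
      exact hspan c hc hce
  have hsum (t : ℕ) (ht : t ≤ T) (c : ℕ → ℤ) :
      ∑ s ∈ Finset.range t, (c s : ℝ) * v (Function.update u T i s)
        = ∑ s ∈ Finset.range t, (c s : ℝ) * v (u s) :=
    Finset.sum_congr rfl fun s hs => by
      rw [Function.update_of_ne (by have := Finset.mem_range.1 hs; omega)]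
  have hbd (t : ℕ) (ht : t ≤ T) (c : ℕ → ℤ) :
      (∀ s < t, |c s| < (Function.update m T k s : ℕ)) ↔ ∀ s < t, |c s| < m s :=
    forall₂_congr fun s hs => by rw [Function.update_of_ne (by omega)]
  have hcases {P : ℕ → Prop} (h1 : ∀ t < T, P t) (h2 : P T) : ∀ t < T + 1, P t := fun t ht => by
    rcases Nat.lt_succ_iff_lt_or_eq.1 ht with ht | rfl
    exacts [h1 t ht, h2]
  refine ⟨Function.update u T i, Function.update m T k, ?_, ?_, ?_, ?_, ?_⟩
  · refine hcases (fun t ht => ?_) (by simpa using hi)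
    rw [Function.update_of_ne ht.ne]
    exact h.notMem t ht
  · refine hcases (fun t ht => ?_) (by simpa using hk2)
    rw [Function.update_of_ne ht.ne]
    exact h.two_le t ht
  · refine hcases (fun t ht => ?_) (by simpa using hkq)
    rw [Function.update_of_ne ht.ne]
    exact h.le t ht
  · refine hcases (fun t ht c hc j hj0 hj => ?_) fun c hc j hj0 hj heq => ?_
    · rw [hbd t ht.le] at hc
      rw [hsum t ht.le]
      rw [Function.update_of_ne ht.ne] at hj ⊢
      exact h.minimal t ht c hc j hj0 hj
    · rw [hbd T le_rfl] at hc
      rw [hsum T le_rfl] at heq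
      rw [Function.update_self] at hj heq
      exact hmin j hj ⟨hj0, Or.inr ⟨c, hc, heq⟩⟩
  · refine hcases (fun t ht => ?_) ?_
    · simp only [hbd t ht.le, hsum t ht.le]
      rw [Function.update_of_ne ht.ne, Function.update_of_ne ht.ne]
      exact h.relation t ht
    · simp only [hbd T le_rfl, hsum T le_rfl, Function.update_self]
      exact hk

end IsGeneratorChain

lemma exists_maximal_chain {n : ℕ} (v : Fin n → ℝ) (E : Finset (Fin n)) (q T₀ : ℕ) (hq : 2 ≤ q)
    (i₀ : Fin n) (hT₀ : ∀ u m, ¬ IsGeneratorChain v E q T₀ u m) :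
    ∃ T u m, T < T₀ ∧ IsGeneratorChain v E q T u m ∧ ∀ i ∉ E, ∃ c : ℕ → ℤ,
      (∀ s < T, |c s| < m s) ∧ v i = ∑ s ∈ Finset.range T, (c s : ℝ) * v (u s) := by
  by_contra! hcon
  have hall : ∀ T ≤ T₀, ∃ u m, IsGeneratorChain v E q T u m := by
    intro T
    induction T with
    | zero =>
      exact fun _ => ⟨fun _ => i₀, fun _ => 0, by simp, by simp, by simp, by simp, by simp⟩
    | succ T ih =>
      intro hT
      obtain ⟨u, m, h⟩ := ih (by omega)
      obtain ⟨i, hi, hspan⟩ := hcon T u m (by omega) h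
      exact h.exists_succ hq hi hspan
  obtain ⟨u, m, h⟩ := hall T₀ le_rfl
  exact hT₀ u m h

lemma exists_fin_sum_eq {α : Type*} [Nonempty α] (r : ℕ) (F : Finset α) (hF : F.card ≤ r) :
    ∃ (e : Fin r → α) (χ : Fin r → ℤ), (∀ t, |χ t| ≤ 1) ∧
      ∀ f : α → ℝ, ∑ s ∈ F, f s = ∑ t, (χ t : ℝ) * f (e t) := by
  refine ⟨fun t => if h : (t : ℕ) < F.card then F.equivFin.symm ⟨t, h⟩ else Classical.arbitrary α,
    fun t => if (t : ℕ) < F.card then 1 else 0, fun t => ?_, fun f => ?_⟩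
  · beta_reduce
    split_ifs <;> simp
  · set g : ℕ → ℝ := fun t => if h : t < F.card then f (F.equivFin.symm ⟨t, h⟩) else 0 with hg
    have h1 : ∑ t : Fin r, g t = ∑ t : Fin F.card, g t := by
      rw [← Finset.sum_range, ← Finset.sum_range]
      symm
      refine Finset.sum_subset (Finset.range_subset_range.2 hF) fun t _ ht => ?_
      simp [hg, Finset.mem_range.not.1 ht]
    have h2 : ∑ t : Fin F.card, g t = ∑ s ∈ F, f s := by
      rw [← Finset.sum_coe_sort F, ← F.equivFin.symm.sum_comp]
      simp [hg]
    rw [← h2, ← h1]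
    refine Finset.sum_congr rfl fun t _ => ?_
    simp only [hg]
    split_ifs <;> simp

/-- Inverse Littlewood-Offord theorem: if a linear form is polynomially concentrated, then up to
a common denominator all but `n ^ ε` of its coefficients are bounded integer combinations of
boundedly many of them. -/
lemma inverse_littlewood_offord {ε μ C : ℝ} (hε0 : 0 < ε) (hε1 : ε ≤ 1) (hμ0 : 0 < μ)
    (hμ1 : μ ≤ 1) (hC : 0 < C) :
    ∃ r c n₀ : ℕ, ∀ n : ℕ, n₀ ≤ n → ∀ (v : Fin n → ℝ) (a : ℝ),
      (n : ℝ) ^ (-C) ≤ ∑ s : Fin n → Fin 3, signWeight μ s *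
        (if ∑ i, v i * etaV (s i) = a then 1 else 0) →
      ∃ (w : Fin r → Fin n) (k : ℤ) (E : Finset (Fin n)), (E.card : ℝ) ≤ (n : ℝ) ^ ε ∧ k ≠ 0 ∧
        |k| ≤ (n : ℤ) ^ c ∧ ∀ i ∉ E, ∃ b : Fin r → ℤ, (∀ t, |b t| ≤ (n : ℤ) ^ c) ∧
          (k : ℝ) * v i = ∑ t, (b t : ℝ) * v (w t) := by
  have hlog : ∀ᶠ x : ℝ in Filter.atTop, Real.log x ≤ μ / (128 * (C + 1)) * x ^ (ε / 2) := by
    have h := (isLittleO_log_rpow_atTop (show 0 < ε / 2 by positivity)).bound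
      (show 0 < μ / (128 * (C + 1)) by positivity)
    filter_upwards [h, Filter.eventually_ge_atTop 0] with x hx hx0
    rw [Real.norm_eq_abs, Real.norm_of_nonneg (Real.rpow_nonneg hx0 _)] at hx
    exact (le_abs_self _).trans hx
  have hexp : ∀ᶠ x : ℝ in Filter.atTop, x ^ (C + 1) < Real.exp (Real.log 2 * x ^ (ε / 8)) := by
    have h := (isLittleO_rpow_exp_pos_mul_atTop (8 * (C + 1) / ε)
      (Real.log_pos (by norm_num : (1 : ℝ) < 2))).bound (show (0 : ℝ) < 1 / 2 by norm_num)
    have h' := (tendsto_rpow_atTop (show 0 < ε / 8 by positivity)).eventually h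
    filter_upwards [h', Filter.eventually_ge_atTop 0] with x hx hx0
    rw [Real.norm_of_nonneg (by positivity), Real.norm_of_nonneg (Real.exp_pos _).le,
      ← Real.rpow_mul hx0, show ε / 8 * (8 * (C + 1) / ε) = C + 1 by field_simp] at hx
    have := Real.exp_pos (Real.log 2 * x ^ (ε / 8))
    linarith
  obtain ⟨n₀, hn₀⟩ := Filter.eventually_atTop.1
    (tendsto_natCast_atTop_atTop.eventually
      (hlog.and (hexp.and (Filter.eventually_ge_atTop (16 : ℝ)))))
  refine ⟨⌈8 * (C + 1) / ε⌉₊, ⌈2 * C + 3⌉₊, n₀, fun n hn v a h => ?_⟩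
  obtain ⟨hlog, hexp, hn16⟩ := hn₀ n hn
  set x : ℝ := (n : ℝ) with hx
  have hx0 : 0 < x := by linarith
  have hx1 : 1 < x := by linarith
  set q : ℕ := ⌈x ^ (ε / 8)⌉₊ with hq
  have hx8 : 1 < x ^ (ε / 8) := Real.one_lt_rpow hx1 (by positivity)
  have hqlow : x ^ (ε / 8) ≤ q := Nat.le_ceil _
  have hq2 : 2 ≤ q := Nat.lt_ceil.2 (by simpa using hx8)
  have hqup : (q : ℝ) ≤ 2 * x ^ (ε / 8) := by
    have := Nat.ceil_lt_add_one (show 0 ≤ x ^ (ε / 8) by positivity)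
    linarith
  have hqn : (q : ℝ) ≤ x := by
    have : q ≤ n := Nat.ceil_le.2 (Real.rpow_le_self_of_one_le hx1.le (by linarith))
    exact Nat.cast_le.2 this
  have hB : 16 / x ^ (-C) ≤ x ^ (C + 1) := by
    rw [Real.rpow_neg hx0.le, div_inv_eq_mul, Real.rpow_add_one hx0.ne', mul_comm]
    gcongr
  obtain ⟨E, hE, hgrowth⟩ := exists_sums_card_le (m := 2 / μ * (C + 1) * Real.log x)
    (n' := x ^ ε) hμ0 hμ1 v (Real.rpow_pos_of_pos hx0 _) h
    (by
      rw [show -(μ / 2) * (2 / μ * (C + 1) * Real.log x) = Real.log x * (-C - 1) by field_simp; ring,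
        ← Real.rpow_def_of_pos hx0, Real.rpow_sub_one hx0.ne']
      gcongr
      linarith)
    (by have := Real.log_pos hx1; positivity) (by positivity) (q * q)
    (by
      push_cast
      have h1 : ((q : ℝ) * q) ^ 2 ≤ 16 * x ^ (ε / 2) := by
        calc ((q : ℝ) * q) ^ 2 = (q : ℝ) ^ 4 := by ring
          _ ≤ (2 * x ^ (ε / 8)) ^ 4 := by gcongr
          _ = 16 * x ^ (ε / 2) := by
            rw [mul_pow, ← Real.rpow_mul_natCast hx0.le]
            norm_num
            ring_nf
      have hlog0 := Real.log_pos hx1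
      calc ((q : ℝ) * q) ^ 2 * (2 / μ * (C + 1) * Real.log x)
          ≤ 16 * x ^ (ε / 2) * (2 / μ * (C + 1) * (μ / (128 * (C + 1)) * x ^ (ε / 2))) := by
            gcongr
        _ = x ^ (ε / 2) * x ^ (ε / 2) / 4 := by field_simp; ring
        _ = x ^ ε / 4 := by rw [← Real.rpow_add hx0]; ring_nf)
  have hprod {T : ℕ} (hT : T ≤ q) {u : ℕ → Fin n} {m : ℕ → ℕ}
      (hch : IsGeneratorChain v E q T u m) :
      ((∏ t ∈ Finset.range T, m t : ℕ) : ℝ) ≤ x ^ (C + 1) :=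
    (hch.prod_le (Nat.mul_le_mul_right q hT) hgrowth).trans hB
  have htwo {T : ℕ} (hT : T ≤ q) {u : ℕ → Fin n} {m : ℕ → ℕ}
      (hch : IsGeneratorChain v E q T u m) : (2 : ℝ) ^ T ≤ x ^ (C + 1) := by
    refine le_trans ?_ (hprod hT hch)
    have : 2 ^ T ≤ ∏ t ∈ Finset.range T, m t := by
      have := Finset.pow_card_le_prod (Finset.range T) m 2
        fun t ht => hch.two_le t (Finset.mem_range.1 ht)
      simpa using this
    exact_mod_cast this
  have hn0 : 0 < n := Nat.cast_pos.1 hx0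
  obtain ⟨T, u, m, hT, hch, hspan⟩ := exists_maximal_chain v E q q hq2 ⟨0, hn0⟩ fun u m hch => by
    have h1 := htwo le_rfl hch
    have h2 : Real.exp (Real.log 2 * x ^ (ε / 8)) ≤ 2 ^ q := by
      rw [← Real.rpow_def_of_pos two_pos, ← Real.rpow_natCast]
      exact Real.rpow_le_rpow_of_exponent_le one_le_two hqlow
    linarith
  have hD := hprod hT.le hch
  have h2T := htwo hT.le hch
  set D : ℕ := ∏ t ∈ Finset.range T, m t with hDdef
  set F := (Finset.range T).filter fun t => m t = q with hF
  have hFr : F.card ≤ ⌈8 * (C + 1) / ε⌉₊ := by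
    have h1 : q ^ F.card ≤ D := by
      calc q ^ F.card = ∏ t ∈ F, m t := by
            rw [← Finset.prod_const]
            exact Finset.prod_congr rfl fun t ht => (Finset.mem_filter.1 ht).2.symm
        _ ≤ D := Finset.prod_le_prod_of_subset_of_one_le' (Finset.filter_subset _ _)
            fun t ht _ => le_trans one_le_two (hch.two_le t (Finset.mem_range.1 ht))
    have h2 : x ^ (ε / 8 * F.card) ≤ x ^ (C + 1) := by
      rw [Real.rpow_mul_natCast hx0.le]
      refine le_trans (pow_le_pow_left₀ (by positivity) hqlow _) (le_trans ?_ hD)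
      exact_mod_cast h1
    have h3 := (Real.rpow_le_rpow_left_iff hx1).1 h2
    have h4 : (F.card : ℝ) ≤ 8 * (C + 1) / ε := by
      rw [le_div_iff₀ hε0]
      linarith
    exact_mod_cast h4.trans (Nat.le_ceil _)
  have hpow {z : ℤ} (hz : ((z : ℤ) : ℝ) ≤ x ^ (2 * C + 3)) : z ≤ (n : ℤ) ^ ⌈2 * C + 3⌉₊ := by
    have h1 : x ^ (2 * C + 3) ≤ x ^ ⌈2 * C + 3⌉₊ := by
      rw [← Real.rpow_natCast]
      exact Real.rpow_le_rpow_of_exponent_le hx1.le (Nat.le_ceil _)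
    have h2 := hz.trans h1
    rw [hx] at h2
    exact_mod_cast h2
  obtain ⟨e, χ, hχ, hsum⟩ := exists_fin_sum_eq _ F hFr
  have hD0 : D ≠ 0 := Finset.prod_ne_zero_iff.2 fun t ht => by
    have := hch.two_le t (Finset.mem_range.1 ht)
    omega
  refine ⟨fun t => u (e t), D, E, hE, by exact_mod_cast hD0, ?_, fun i hi => ?_⟩
  · rw [abs_of_nonneg (by positivity)]
    refine hpow ?_
    push_cast
    exact hD.trans (Real.rpow_le_rpow_of_exponent_le hx1.le (by linarith))
  · obtain ⟨c, hc, hvc⟩ := hspan i hi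
    obtain ⟨b, hb, hbe⟩ := hch.exists_eq_sum_free le_rfl c hc
    refine ⟨fun t => χ t * b (e t), fun t => ?_, ?_⟩
    · have h1 : |χ t * b (e t)| ≤ D * q * 2 ^ T := by
        rw [abs_mul]
        exact (mul_le_of_le_one_left (abs_nonneg _) (hχ t)).trans (hb _)
      refine h1.trans (hpow ?_)
      push_cast
      calc (D : ℝ) * q * 2 ^ T ≤ x ^ (C + 1) * x * x ^ (C + 1) := by gcongr
        _ = x ^ (2 * C + 3) := by
          rw [← Real.rpow_add_one hx0.ne', ← Real.rpow_add hx0]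
          ring_nf
    · rw [hvc, Int.cast_natCast, hbe, hsum]
      refine Finset.sum_congr rfl fun t _ => ?_
      push_cast
      ring

/-- Every symmetric GAP is contained in a proper symmetric GAP of no larger rank, with
polynomial loss in the size. -/
lemma exists_proper_gap (r : ℕ) (g : Fin r → ℝ) (N : ℕ) (hN : 1 ≤ N) :
    ∃ Q : Set ℝ, IsProperSymGAPSet Q r ((3 * (4 * (N : ℝ)) ^ 2 ^ r) ^ r) ∧
      ∀ m : Fin r → ℤ, (∀ t, |m t| ≤ (N : ℤ)) → ∑ t, (m t : ℝ) * g t ∈ Q := by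
  induction r generalizing N with
  | zero =>
    refine ⟨_, ⟨0, g, fun _ => N, le_rfl, rfl, fun _ _ _ _ _ => Subsingleton.elim _ _, by simp⟩,
      fun m hm => ⟨m, hm, rfl⟩⟩
  | succ r ih =>
    have hN' : (1 : ℝ) ≤ N := by exact_mod_cast hN
    by_cases hprop : ∀ m m' : Fin (r + 1) → ℤ, (∀ i, |m i| ≤ (N : ℤ)) →
      (∀ i, |m' i| ≤ (N : ℤ)) → (∑ i, (m i : ℝ) * g i) = (∑ i, (m' i : ℝ) * g i) → m = m'
    · refine ⟨_, ⟨r + 1, g, fun _ => N, le_rfl, rfl, hprop, ?_⟩, fun m hm => ⟨m, hm, rfl⟩⟩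
      rw [Finset.prod_const, Finset.card_univ, Fintype.card_fin]
      gcongr
      have : (4 * (N : ℝ)) ≤ (4 * (N : ℝ)) ^ 2 ^ (r + 1) :=
        le_self_pow₀ (by linarith) (by positivity)
      linarith
    push Not at hprop
    obtain ⟨m, m', hm, hm', heq, hne⟩ := hprop
    obtain ⟨p, hp⟩ := Function.ne_iff.1 hne
    set d : Fin (r + 1) → ℤ := fun i => m i - m' i with hd
    have hdp : d p ≠ 0 := sub_ne_zero.2 hp
    have hdp' : (d p : ℝ) ≠ 0 := by exact_mod_cast hdp
    have hdN (i : Fin (r + 1)) : |d i| ≤ 2 * N := by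
      have := abs_sub (m i) (m' i)
      have := hm i
      have := hm' i
      linarith
    have hrel : ∑ i, (d i : ℝ) * g i = 0 := by
      simp only [hd]
      push_cast
      simp only [sub_mul, Finset.sum_sub_distrib]
      linarith
    obtain ⟨Q, ⟨r', g', N', hr', hQ, hproper, hsize⟩, hmem⟩ :=
      ih (fun i => g (p.succAbove i) / d p) (4 * N ^ 2) (by nlinarith)
    refine ⟨Q, ⟨r', g', N', hr'.trans (Nat.le_succ r), hQ, hproper, hsize.trans ?_⟩,
      fun x hx => ?_⟩
    · have h1 : (4 * ((4 * N ^ 2 : ℕ) : ℝ)) ^ 2 ^ r = (4 * (N : ℝ)) ^ 2 ^ (r + 1) := by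
        rw [pow_succ' 2 r, pow_mul]
        push_cast
        ring_nf
      rw [h1]
      refine pow_le_pow_right₀ ?_ (Nat.le_succ r)
      have : 1 ≤ (4 * (N : ℝ)) ^ 2 ^ (r + 1) := one_le_pow₀ (by linarith)
      linarith
    · have h1 := hmem (fun i => d p * x (p.succAbove i) - x p * d (p.succAbove i)) fun i => by
        refine (abs_sub _ _).trans ?_
        rw [abs_mul, abs_mul]
        have h2 := mul_le_mul (hdN p) (hx (p.succAbove i)) (abs_nonneg _) (by positivity)
        have h3 := mul_le_mul (hx p) (hdN (p.succAbove i)) (abs_nonneg _) (by positivity)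
        push_cast
        nlinarith
      convert h1 using 1
      rw [Fin.sum_univ_succAbove _ p] at hrel ⊢
      have h4 : ∑ i, ((d p * x (p.succAbove i) - x p * d (p.succAbove i) : ℤ) : ℝ)
            * (g (p.succAbove i) / d p)
          = ∑ i, (x (p.succAbove i) : ℝ) * g (p.succAbove i)
            - x p / d p * ∑ i, (d (p.succAbove i) : ℝ) * g (p.succAbove i) := by
        rw [Finset.mul_sum, ← Finset.sum_sub_distrib]
        refine Finset.sum_congr rfl fun i _ => ?_
        push_cast
        field_simp
      rw [h4, eq_neg_of_add_eq_zero_right hrel]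
      field_simp
      ring

/-- Weighted pigeonhole principle. -/
lemma exists_le_mul_sum_fiber {α κ : Type*} [DecidableEq κ] (S : Finset α) (W : α → ℝ) (hW : ∀ t ∈ S, 0 ≤ W t)
    (K : Finset κ) (hK : K.Nonempty) (f : α → κ) (hf : ∀ t ∈ S, f t ∈ K) {B : ℝ}
    (hB : (K.card : ℝ) ≤ B) :
    ∃ κ₀ ∈ K, ∑ t ∈ S, W t ≤ B * ∑ t ∈ S.filter (fun t => f t = κ₀), W t := by
  obtain ⟨κ₀, hκ₀, h⟩ := Finset.exists_le_sum_fiber_of_maps_to_of_nsmul_le_sum hf hK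
    (b := (∑ t ∈ S, W t) / K.card) (w := W) (by
      have : (K.card : ℝ) ≠ 0 := by exact_mod_cast hK.card_pos.ne'
      rw [nsmul_eq_mul, mul_div_cancel₀ _ this])
  refine ⟨κ₀, hκ₀, ?_⟩
  have hK0 : (0 : ℝ) < K.card := by exact_mod_cast hK.card_pos
  rw [div_le_iff₀ hK0] at h
  refine h.trans ?_
  rw [mul_comm]
  exact mul_le_mul_of_nonneg_right hB
    (Finset.sum_nonneg fun t ht => hW t (Finset.mem_filter.1 ht).1)

lemma card_Icc_neg_pow_le {n c : ℕ} (hn : 3 ≤ n) :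
    (Finset.Icc (-(n : ℤ) ^ c) ((n : ℤ) ^ c)).card ≤ n ^ (c + 1) := by
  rw [Int.card_Icc]
  have h1 : (1 : ℤ) ≤ (n : ℤ) ^ c := one_le_pow₀ (by omega)
  have h2 : (n : ℤ) ^ (c + 1) = n * (n : ℤ) ^ c := pow_succ' _ _
  have h3 : (3 : ℤ) * (n : ℤ) ^ c ≤ n * (n : ℤ) ^ c := by
    gcongr
    exact_mod_cast hn
  zify
  rw [Int.toNat_of_nonneg (by linarith)]
  linarith

/-- If few elements are exceptional for each sample, few elements are exceptional for at least
half of the samples. -/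
lemma card_filter_half_lt_le {α ι : Type*} [Fintype ι] [DecidableEq ι] (S : Finset α) (W : α → ℝ)
    (hW : ∀ t ∈ S, 0 ≤ W t) (hS : 0 < ∑ t ∈ S, W t) (E : α → Finset ι) {B : ℝ}
    (hE : ∀ t ∈ S, ((E t).card : ℝ) ≤ B) :
    ((Finset.univ.filter fun i =>
      (∑ t ∈ S, W t) / 2 < ∑ t ∈ S.filter (fun t => i ∈ E t), W t).card : ℝ) ≤ 2 * B := by
  set Bad := Finset.univ.filter fun i =>
    (∑ t ∈ S, W t) / 2 < ∑ t ∈ S.filter (fun t => i ∈ E t), W t with hBad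
  have h1 : (Bad.card : ℝ) * ((∑ t ∈ S, W t) / 2)
      ≤ ∑ i, ∑ t ∈ S.filter (fun t => i ∈ E t), W t := by
    rw [← nsmul_eq_mul]
    refine (Finset.card_nsmul_le_sum Bad (fun i => ∑ t ∈ S.filter (fun t => i ∈ E t), W t) _
      fun i hi => (Finset.mem_filter.1 hi).2.le).trans ?_
    exact Finset.sum_le_sum_of_subset_of_nonneg (Finset.subset_univ _) fun i _ _ =>
      Finset.sum_nonneg fun t ht => hW t (Finset.mem_filter.1 ht).1
  have h2 : ∑ i, ∑ t ∈ S.filter (fun t => i ∈ E t), W t ≤ B * ∑ t ∈ S, W t := by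
    simp only [Finset.sum_filter]
    rw [Finset.sum_comm, Finset.mul_sum]
    refine Finset.sum_le_sum fun t ht => ?_
    rw [← Finset.sum_filter, Finset.filter_univ_mem, Finset.sum_const, nsmul_eq_mul]
    exact mul_le_mul_of_nonneg_right (hE t ht) (hW t ht)
  nlinarith

/-- Left half of the matrix relation, in terms of the rows of the matrix. -/
lemma exists_row_relation {ε μ C : ℝ} (hε0 : 0 < ε) (hε1 : ε ≤ 1) (hμ0 : 0 < μ)
    (hμ1 : μ ≤ 1) (hC : 0 < C) :
    ∃ r c n₀ : ℕ, ∀ n : ℕ, n₀ ≤ n → ∀ (A : Matrix (Fin n) (Fin n) ℝ) (a : ℝ),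
      (n : ℝ) ^ (-C) ≤ ∑ t : Fin n → Fin 3, ∑ s : Fin n → Fin 3,
        signWeight μ t * (signWeight μ s *
          (if ∑ i, ∑ j, A i j * etaV (s i) * etaV (t j) = a then 1 else 0)) →
      ∃ (I₀ I : Finset (Fin n)) (k : ℤ) (kk : Fin n → Fin n → ℤ),
        I₀.card ≤ r ∧ (n : ℝ) - 3 * (n : ℝ) ^ ε ≤ I.card ∧ Disjoint I I₀ ∧ k ≠ 0 ∧
        |k| ≤ (n : ℤ) ^ c ∧ (∀ i ∈ I, ∀ i₀, |kk i i₀| ≤ (n : ℤ) ^ c) ∧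
        ∀ i ∈ I, ∃ (g : Fin r → ℝ) (E : Finset (Fin n)), (E.card : ℝ) ≤ (n : ℝ) ^ ε ∧
          ∀ j ∉ E, ∃ m : Fin r → ℤ, (∀ τ, |m τ| ≤ (n : ℤ) ^ c) ∧
            (k : ℝ) * A i j + ∑ i₀ ∈ I₀, (kk i i₀ : ℝ) * A i₀ j = ∑ τ, (m τ : ℝ) * g τ := by
  obtain ⟨r, c, n₁, hilo₁⟩ := inverse_littlewood_offord (C := C + 1) hε0 hε1 hμ0 hμ1 (by linarith)
  obtain ⟨r₂, c₂, n₂, hilo₂⟩ := inverse_littlewood_offord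
    (C := C + 1 + ((r + (c + 1)) + (c + 1) * r : ℕ)) hε0 hε1 hμ0 hμ1 (by positivity)
  obtain ⟨n₃, hn₃⟩ := Filter.eventually_atTop.1
    (((tendsto_rpow_atTop hε0).comp tendsto_natCast_atTop_atTop).eventually_ge_atTop (r : ℝ))
  refine ⟨r + r₂, c + 1 + c₂, n₁ + n₂ + n₃ + r + 4, fun n hn A a h => ?_⟩
  have hn0 : 0 < n := by omega
  have : Nonempty (Fin n) := ⟨⟨0, hn0⟩⟩
  have hn4 : (4 : ℝ) ≤ n := by exact_mod_cast (by omega : 4 ≤ n)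
  have hnpos : (0 : ℝ) < n := by linarith
  have hrε : (r : ℝ) ≤ (n : ℝ) ^ ε := hn₃ n (by omega)
  have hW (t : Fin n → Fin 3) : 0 ≤ signWeight μ t := signWeight_nonneg hμ0 hμ1 t
  set v : (Fin n → Fin 3) → Fin n → ℝ := fun t i => ∑ j, A i j * etaV (t j) with hv
  have hvs (t s : Fin n → Fin 3) :
      ∑ i, ∑ j, A i j * etaV (s i) * etaV (t j) = ∑ i, v t i * etaV (s i) := by
    simp only [hv, Finset.sum_mul]
    exact Finset.sum_congr rfl fun i _ => Finset.sum_congr rfl fun j _ => by ring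
  simp only [hvs, ← Finset.mul_sum] at h
  set p : (Fin n → Fin 3) → ℝ := fun t => ∑ s : Fin n → Fin 3, signWeight μ s *
    (if ∑ i, v t i * etaV (s i) = a then 1 else 0) with hp
  have hp1 (t : Fin n → Fin 3) : p t ≤ 1 := by
    rw [← sum_signWeight (n := n) μ]
    refine Finset.sum_le_sum fun s _ => mul_le_of_le_one_right (hW s) ?_
    split_ifs <;> norm_num
  set ρ : ℝ := (n : ℝ) ^ (-C) with hρ
  have hρ0 : 0 < ρ := Real.rpow_pos_of_pos hnpos _
  set G : Finset (Fin n → Fin 3) := Finset.univ.filter fun t => ρ / 2 ≤ p t with hG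
  have hGW : ρ / 2 ≤ ∑ t ∈ G, signWeight μ t := by
    have h1 : ∑ t, signWeight μ t * p t
        ≤ ∑ t, ((if ρ / 2 ≤ p t then signWeight μ t else 0) + signWeight μ t * (ρ / 2)) := by
      refine Finset.sum_le_sum fun t _ => ?_
      split_ifs with ht
      · nlinarith [hW t, hp1 t]
      · rw [zero_add]
        exact mul_le_mul_of_nonneg_left (not_le.1 ht).le (hW t)
    rw [Finset.sum_add_distrib, ← Finset.sum_mul, sum_signWeight, ← Finset.sum_filter] at h1
    linarith
  have hρ1 : (n : ℝ) ^ (-(C + 1)) ≤ ρ / 2 := by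
    rw [neg_add, ← sub_eq_add_neg, Real.rpow_sub_one hnpos.ne']
    gcongr
    linarith
  choose! w k E hE hk0 hk b hb hbe using fun t (ht : t ∈ G) =>
    hilo₁ n (by omega) (v t) a (hρ1.trans (Finset.mem_filter.1 ht).2)
  -- A common choice of the basis and of the denominator.
  have hIcc : ((Finset.Icc (-(n : ℤ) ^ c) ((n : ℤ) ^ c)).card : ℝ) ≤ (n : ℝ) ^ (c + 1) := by
    exact_mod_cast card_Icc_neg_pow_le (by omega)
  have hIcc0 : (Finset.Icc (-(n : ℤ) ^ c) ((n : ℤ) ^ c)).Nonempty :=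
    ⟨0, Finset.mem_Icc.2 ⟨by simp, by positivity⟩⟩
  obtain ⟨⟨w₀, k₀⟩, -, hG'⟩ := exists_le_mul_sum_fiber G (signWeight μ) (fun t _ => hW t)
    ((Finset.univ : Finset (Fin r → Fin n)) ×ˢ Finset.Icc (-(n : ℤ) ^ c) ((n : ℤ) ^ c))
    (Finset.univ_nonempty.product hIcc0) (fun t => (w t, k t))
    (fun t ht => Finset.mem_product.2 ⟨Finset.mem_univ _, Finset.mem_Icc.2 (abs_le.1 (hk t ht))⟩)
    (B := (n : ℝ) ^ (r + (c + 1))) (by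
      rw [Finset.card_product, Finset.card_univ, Fintype.card_fun, Fintype.card_fin,
        Fintype.card_fin, pow_add]
      push_cast
      gcongr)
  set G' := G.filter fun t => (w t, k t) = (w₀, k₀) with hG'def
  have hmemG' {t : Fin n → Fin 3} (ht : t ∈ G') : t ∈ G ∧ w t = w₀ ∧ k t = k₀ := by
    obtain ⟨h1, h2⟩ := Finset.mem_filter.1 ht
    exact ⟨h1, Prod.ext_iff.1 h2⟩
  have hG'0 : 0 < ∑ t ∈ G', signWeight μ t := by
    by_contra hcon
    have := mul_nonpos_of_nonneg_of_nonpos (by positivity : 0 ≤ (n : ℝ) ^ (r + (c + 1)))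
      (not_lt.1 hcon)
    linarith
  obtain ⟨t₀, ht₀⟩ : G'.Nonempty := Finset.nonempty_of_sum_ne_zero hG'0.ne'
  set Bad : Finset (Fin n) := Finset.univ.filter fun i =>
    (∑ t ∈ G', signWeight μ t) / 2 < ∑ t ∈ G'.filter (fun t => i ∈ E t), signWeight μ t with hBad
  have hBadcard : (Bad.card : ℝ) ≤ 2 * (n : ℝ) ^ ε :=
    card_filter_half_lt_le G' (signWeight μ) (fun t _ => hW t) hG'0 E
      fun t ht => hE t (hmemG' ht).1
  -- A common choice of the coefficients, for each index that is not exceptional.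
  have hcoef : ∀ i ∉ Bad, ∃ β : Fin r → ℤ, (∀ τ, |β τ| ≤ (n : ℤ) ^ c) ∧
      (n : ℝ) ^ (-(C + 1 + ((r + (c + 1)) + (c + 1) * r : ℕ))) ≤ ∑ s : Fin n → Fin 3,
        signWeight μ s * (if ∑ j, ((k₀ : ℝ) * A i j - ∑ τ, (β τ : ℝ) * A (w₀ τ) j) * etaV (s j) = 0
          then 1 else 0) := by
    intro i hi
    have hhalf : (∑ t ∈ G', signWeight μ t) / 2
        ≤ ∑ t ∈ G'.filter (fun t => ¬ i ∈ E t), signWeight μ t := by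
      have h1 := Finset.sum_filter_add_sum_filter_not G' (fun t => i ∈ E t) (signWeight μ)
      have h2 : ¬ _ := fun h => hi (Finset.mem_filter.2 ⟨Finset.mem_univ i, h⟩)
      linarith [not_lt.1 h2]
    obtain ⟨β, hβ, hβW⟩ := exists_le_mul_sum_fiber (G'.filter fun t => ¬ i ∈ E t) (signWeight μ)
      (fun t _ => hW t) (Fintype.piFinset fun _ : Fin r =>
        Finset.Icc (-(n : ℤ) ^ c) ((n : ℤ) ^ c))
      (Fintype.piFinset_nonempty.2 fun _ => hIcc0) (fun t => b t i)
      (fun t ht => by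
        obtain ⟨ht, hti⟩ := Finset.mem_filter.1 ht
        exact Fintype.mem_piFinset.2 fun τ =>
          Finset.mem_Icc.2 (abs_le.1 (hb t (hmemG' ht).1 i hti τ)))
      (B := (n : ℝ) ^ ((c + 1) * r)) (by
        rw [Fintype.card_piFinset_const, pow_mul]
        push_cast
        gcongr)
    refine ⟨β, fun τ => abs_le.2 (Finset.mem_Icc.1 (Fintype.mem_piFinset.1 hβ τ)), ?_⟩
    have hsub : ∑ t ∈ (G'.filter fun t => ¬ i ∈ E t).filter (fun t => b t i = β), signWeight μ t
        ≤ ∑ s : Fin n → Fin 3, signWeight μ s *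
          (if ∑ j, ((k₀ : ℝ) * A i j - ∑ τ, (β τ : ℝ) * A (w₀ τ) j) * etaV (s j) = 0
            then 1 else 0) := by
      simp only [mul_ite, mul_one, mul_zero]
      rw [← Finset.sum_filter]
      refine Finset.sum_le_sum_of_subset_of_nonneg (fun t ht => ?_) fun t _ _ => hW t
      obtain ⟨ht, hbβ⟩ := Finset.mem_filter.1 ht
      obtain ⟨ht, hti⟩ := Finset.mem_filter.1 ht
      obtain ⟨htG, hw, hkt⟩ := hmemG' ht
      refine Finset.mem_filter.2 ⟨Finset.mem_univ _, ?_⟩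
      have h1 := hbe t htG i hti
      rw [hw, hkt, hbβ] at h1
      simp only [hv] at h1
      simp only [sub_mul, Finset.sum_sub_distrib, Finset.sum_mul]
      rw [Finset.sum_comm, sub_eq_zero]
      simp only [Finset.mul_sum, ← mul_assoc] at h1
      exact h1
    refine le_trans ?_ hsub
    set X := ∑ t ∈ (G'.filter fun t => ¬ i ∈ E t).filter (fun t => b t i = β), signWeight μ t
    have h5 : ρ ≤ 4 * (n : ℝ) ^ ((r + (c + 1)) + (c + 1) * r) * X := by
      have h6 : ∑ t ∈ G', signWeight μ t ≤ 2 * ((n : ℝ) ^ ((c + 1) * r) * X) := by linarith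
      have h7 := mul_le_mul_of_nonneg_left h6 (by positivity : 0 ≤ (n : ℝ) ^ (r + (c + 1)))
      rw [pow_add _ (r + (c + 1))]
      linarith
    rw [neg_add, Real.rpow_add hnpos, Real.rpow_neg hnpos.le (Nat.cast _), Real.rpow_natCast,
      neg_add, ← sub_eq_add_neg, Real.rpow_sub_one hnpos.ne', ← div_eq_mul_inv,
      div_div, div_le_iff₀ (by positivity)]
    have hX0 : 0 ≤ X := Finset.sum_nonneg fun t _ => hW t
    refine h5.trans ?_
    rw [mul_comm X]
    gcongr
  choose! β hβ hβW using hcoef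
  refine ⟨Finset.univ.image w₀, Finset.univ \ (Bad ∪ Finset.univ.image w₀), k₀,
    fun i i₀ => -∑ τ, if w₀ τ = i₀ then β i τ else 0, ?_, ?_, ?_, ?_, ?_, ?_, ?_⟩
  · refine Finset.card_image_le.trans ?_
    simp
  · have h1 : (Bad ∪ Finset.univ.image w₀).card ≤ Bad.card + r := by
      refine (Finset.card_union_le _ _).trans (add_le_add_right ?_ _)
      exact Finset.card_image_le.trans (by simp)
    have h2 : ((Bad ∪ Finset.univ.image w₀).card : ℝ) ≤ Bad.card + r := by exact_mod_cast h1
    have h3 := Finset.card_sdiff_add_card_eq_card (Finset.subset_univ (Bad ∪ Finset.univ.image w₀))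
    rw [Finset.card_univ, Fintype.card_fin] at h3
    have h4 : (((Finset.univ \ (Bad ∪ Finset.univ.image w₀)).card : ℝ)
        + (Bad ∪ Finset.univ.image w₀).card) = n := by exact_mod_cast h3
    linarith
  · exact (Finset.sdiff_disjoint).mono_right Finset.subset_union_right
  · rw [← (hmemG' ht₀).2.2]
    exact hk0 t₀ (hmemG' ht₀).1
  · rw [← (hmemG' ht₀).2.2]
    refine (hk t₀ (hmemG' ht₀).1).trans ?_
    exact pow_le_pow_right₀ (by omega) (by omega)
  · intro i hi i₀
    have hi' : i ∉ Bad := fun h => (Finset.mem_sdiff.1 hi).2 (Finset.mem_union_left _ h)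
    rw [abs_neg]
    have h1 : |∑ τ, if w₀ τ = i₀ then β i τ else 0| ≤ r * (n : ℤ) ^ c := by
      refine (Finset.abs_sum_le_sum_abs _ _).trans ?_
      refine (Finset.sum_le_card_nsmul _ _ ((n : ℤ) ^ c) fun τ _ => ?_).trans (by simp)
      split_ifs
      · exact hβ i hi' τ
      · simp
    refine h1.trans ?_
    calc (r : ℤ) * (n : ℤ) ^ c ≤ n * (n : ℤ) ^ c := by gcongr; omega
      _ = (n : ℤ) ^ (c + 1) := (pow_succ' _ _).symm
      _ ≤ (n : ℤ) ^ (c + 1 + c₂) := pow_le_pow_right₀ (by omega) (by omega)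
  · intro i hi
    have hi' : i ∉ Bad := fun h => (Finset.mem_sdiff.1 hi).2 (Finset.mem_union_left _ h)
    obtain ⟨w', k', E', hE', hk'0, -, hrel⟩ := hilo₂ n (by omega)
      (fun j => (k₀ : ℝ) * A i j - ∑ τ, (β i τ : ℝ) * A (w₀ τ) j) 0 (hβW i hi')
    refine ⟨Fin.append (fun _ => 0) fun τ =>
      ((k₀ : ℝ) * A i (w' τ) - ∑ σ, (β i σ : ℝ) * A (w₀ σ) (w' τ)) / k', E', hE', fun j hj => ?_⟩
    obtain ⟨m, hm, hme⟩ := hrel j hj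
    refine ⟨Fin.append (fun _ => 0) m, fun τ => ?_, ?_⟩
    · refine Fin.addCases (fun τ => ?_) (fun τ => ?_) τ
      · simp
      · rw [Fin.append_right]
        exact (hm τ).trans (pow_le_pow_right₀ (by omega) (by omega))
    · have hk'0' : (k' : ℝ) ≠ 0 := by exact_mod_cast hk'0
      have h1 : ∑ i₀ ∈ Finset.univ.image w₀,
          ((-∑ τ, if w₀ τ = i₀ then β i τ else 0 : ℤ) : ℝ) * A i₀ j
          = -∑ τ, (β i τ : ℝ) * A (w₀ τ) j := by
        push_cast
        simp only [neg_mul, Finset.sum_neg_distrib, Finset.sum_mul, ite_mul, zero_mul]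
        rw [Finset.sum_comm]
        congr 1
        refine Finset.sum_congr rfl fun τ _ => ?_
        rw [Finset.sum_ite_eq, if_pos (Finset.mem_image_of_mem _ (Finset.mem_univ τ))]
      rw [h1, ← sub_eq_add_neg, Fin.sum_univ_add]
      simp only [Fin.append_left, Fin.append_right, Int.cast_zero, zero_mul,
        Finset.sum_const_zero, zero_add]
      simp only [mul_div_assoc', ← Finset.sum_div]
      rw [eq_div_iff hk'0', mul_comm]
      exact hme

/-- Conditioning on the second block of variables. -/
lemma probEta_bilinear_eq {n : ℕ} (μ : ℝ) (A : Matrix (Fin n) (Fin n) ℝ) (a : ℝ) :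
    probEta μ (fun xy : (Fin n ⊕ Fin n) → ℝ =>
      ∑ i, ∑ j, A i j * xy (Sum.inl i) * xy (Sum.inr j) = a) =
    ∑ t : Fin n → Fin 3, ∑ s : Fin n → Fin 3, signWeight μ t * (signWeight μ s *
      (if ∑ i, ∑ j, A i j * etaV (s i) * etaV (t j) = a then 1 else 0)) := by
  unfold probEta
  rw [← Fintype.sum_prod_type_right fun p : (Fin n → Fin 3) × (Fin n → Fin 3) =>
    signWeight μ p.2 * (signWeight μ p.1 *
      (if ∑ i, ∑ j, A i j * etaV (p.1 i) * etaV (p.2 j) = a then (1 : ℝ) else 0))]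
  refine Finset.sum_equiv (Equiv.sumArrowEquivProdArrow (Fin n) (Fin n) (Fin 3)) (by simp)
    fun s _ => ?_
  rw [Fintype.prod_sum_type, ← mul_assoc, mul_comm (signWeight μ _)]
  rfl

/-- The bilinear form is symmetric under transposition of the matrix. -/
lemma sum_sum_signWeight_transpose {n : ℕ} (μ : ℝ) (A : Matrix (Fin n) (Fin n) ℝ) (a : ℝ) :
    ∑ t : Fin n → Fin 3, ∑ s : Fin n → Fin 3, signWeight μ t * (signWeight μ s *
      (if ∑ i, ∑ j, A.transpose i j * etaV (s i) * etaV (t j) = a then 1 else 0)) =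
    ∑ t : Fin n → Fin 3, ∑ s : Fin n → Fin 3, signWeight μ t * (signWeight μ s *
      (if ∑ i, ∑ j, A i j * etaV (s i) * etaV (t j) = a then 1 else 0)) := by
  rw [Finset.sum_comm]
  refine Finset.sum_congr rfl fun t _ => Finset.sum_congr rfl fun s _ => ?_
  rw [Finset.sum_comm, mul_left_comm]
  simp only [Matrix.transpose_apply, mul_right_comm _ (etaV (t _)) (etaV (s _))]

/-- A concentrated bilinear form is concentrated at some point. -/
lemma exists_rpow_neg_le_of_le_rhoBmu {n : ℕ} (hn : 2 ≤ n) {μ C : ℝ}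
    {A : Matrix (Fin n) (Fin n) ℝ} (h : (n : ℝ) ^ (-C) ≤ rhoBmu μ n A) :
    ∃ a : ℝ, (n : ℝ) ^ (-(C + 1)) ≤ ∑ t : Fin n → Fin 3, ∑ s : Fin n → Fin 3,
      signWeight μ t * (signWeight μ s *
        (if ∑ i, ∑ j, A i j * etaV (s i) * etaV (t j) = a then 1 else 0)) := by
  have hlt : (n : ℝ) ^ (-(C + 1)) < (n : ℝ) ^ (-C) :=
    Real.rpow_lt_rpow_of_exponent_lt (by exact_mod_cast hn) (by linarith)
  obtain ⟨a, ha⟩ := exists_lt_of_lt_ciSup (hlt.trans_le h)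
  rw [probEta_bilinear_eq] at ha
  exact ⟨a, ha.le⟩

/-- Multiplication on the left by a matrix of row relations. -/
lemma mul_apply_of_row_relation {n : ℕ} {I I₀ : Finset (Fin n)} (hI : Disjoint I I₀) (k : ℝ)
    (kk : Fin n → Fin n → ℝ) {L : Matrix (Fin n) (Fin n) ℝ}
    (hL : ∀ i j, L i j = if i ∈ I then (if j = i then k else if j ∈ I₀ then kk i j else 0)
      else (if j = i then 1 else 0)) (M : Matrix (Fin n) (Fin n) ℝ) (i j : Fin n) :
    (L * M) i j = if i ∈ I then k * M i j + ∑ i₀ ∈ I₀, kk i i₀ * M i₀ j else M i j := by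
  rw [Matrix.mul_apply]
  simp only [hL]
  split_ifs with hi
  · have hi₀ : i ∉ I₀ := Finset.disjoint_left.1 hI hi
    have h1 (x : Fin n) : (if x = i then k else if x ∈ I₀ then kk i x else 0) * M x j
        = (if x = i then k * M x j else 0) + (if x ∈ I₀ then kk i x * M x j else 0) := by
      by_cases hx : x = i
      · subst hx
        simp [hi₀]
      · simp [hx, ite_mul]
    simp only [h1, Finset.sum_add_distrib, Finset.sum_ite_eq', Finset.mem_univ, if_true]
    simp
  · simp [ite_mul]

/-- Multiplication on the right by a matrix of column relations. -/
lemma mul_apply_of_column_relation {n : ℕ} {J J₀ : Finset (Fin n)} (hJ : Disjoint J J₀) (l : ℝ)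
    (ll : Fin n → Fin n → ℝ) {R : Matrix (Fin n) (Fin n) ℝ}
    (hR : ∀ i j, R i j = if j ∈ J then (if i = j then l else if i ∈ J₀ then ll i j else 0)
      else (if i = j then 1 else 0)) (M : Matrix (Fin n) (Fin n) ℝ) (i j : Fin n) :
    (M * R) i j = if j ∈ J then l * M i j + ∑ j₀ ∈ J₀, ll j₀ j * M i j₀ else M i j := by
  rw [← Matrix.transpose_apply (M * R), Matrix.transpose_mul,
    mul_apply_of_row_relation hJ l (fun j i => ll i j) (fun j i => by
      rw [Matrix.transpose_apply, hR])]
  simp only [Matrix.transpose_apply]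

/-- A sequence lying mostly in a GAP still does so after integer relations with few of its
terms are added. -/
lemma exists_proper_gap_of_relation {n r c : ℕ} (hn : 4 ≤ n) (x : Fin n → ℝ) (g : Fin r → ℝ)
    (E : Finset (Fin n))
    (hx : ∀ j ∉ E, ∃ m : Fin r → ℤ, (∀ τ, |m τ| ≤ (n : ℤ) ^ c) ∧ x j = ∑ τ, (m τ : ℝ) * g τ)
    (J J₀ : Finset (Fin n)) (hJ₀ : J₀.card ≤ r) (l : ℤ) (hl : |l| ≤ (n : ℤ) ^ c)
    (ll : Fin n → Fin n → ℤ) (hll : ∀ j ∈ J, ∀ j₀, |ll j j₀| ≤ (n : ℤ) ^ c) :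
    ∃ Q, IsProperSymGAPSet Q (r + r) ((n : ℝ) ^ (((2 * c + 1) * 2 ^ (r + r) + 1) * (r + r))) ∧
      ∀ j ∉ E, (if j ∈ J then (l : ℝ) * x j + ∑ j₀ ∈ J₀, (ll j j₀ : ℝ) * x j₀ else x j) ∈ Q := by
  have hn1 : (1 : ℤ) ≤ n := by omega
  have : Nonempty (Fin n) := ⟨⟨0, by omega⟩⟩
  obtain ⟨e, χ, hχ, hsum⟩ := exists_fin_sum_eq r J₀ hJ₀
  obtain ⟨Q, hQ, hmem⟩ := exists_proper_gap (r + r) (Fin.append g fun τ => x (e τ)) (n ^ (2 * c))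
    (Nat.one_le_pow _ _ (by omega))
  have hcc : (n : ℤ) ^ c * (n : ℤ) ^ c = ((n ^ (2 * c) : ℕ) : ℤ) := by
    push_cast
    rw [two_mul, pow_add]
  have hc1 : (n : ℤ) ^ c ≤ ((n ^ (2 * c) : ℕ) : ℤ) := by
    push_cast
    exact pow_le_pow_right₀ hn1 (by omega)
  refine ⟨Q, ?_, fun j hj => ?_⟩
  · obtain ⟨r', g', N', h1, h2, h3, h4⟩ := hQ
    refine ⟨r', g', N', h1, h2, h3, h4.trans ?_⟩
    have hn4 : (4 : ℝ) ≤ n := by exact_mod_cast hn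
    have h5 : 4 * ((n ^ (2 * c) : ℕ) : ℝ) ≤ (n : ℝ) ^ (2 * c + 1) := by
      push_cast
      rw [pow_succ']
      gcongr
    have h6 : 3 * (4 * ((n ^ (2 * c) : ℕ) : ℝ)) ^ 2 ^ (r + r)
        ≤ (n : ℝ) ^ ((2 * c + 1) * 2 ^ (r + r) + 1) := by
      rw [pow_succ' _ ((2 * c + 1) * _), pow_mul _ (2 * c + 1)]
      gcongr
      linarith
    rw [pow_mul _ (_ * _ + 1)]
    exact pow_le_pow_left₀ (by positivity) h6 _
  · obtain ⟨m, hm, hmx⟩ := hx j hj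
    split_ifs with hjJ
    · have h := hmem (Fin.append (fun τ => l * m τ) fun τ => χ τ * ll j (e τ)) fun τ => by
        refine Fin.addCases (fun τ => ?_) (fun τ => ?_) τ
        · rw [Fin.append_left, abs_mul, ← hcc]
          exact mul_le_mul hl (hm τ) (abs_nonneg _) (by positivity)
        · rw [Fin.append_right, abs_mul]
          refine (mul_le_of_le_one_left (abs_nonneg _) (hχ τ)).trans ?_
          exact (hll j hjJ _).trans hc1
      rw [Fin.sum_univ_add] at h
      simp only [Fin.append_left, Fin.append_right, Int.cast_mul, mul_assoc,
        ← Finset.mul_sum] at h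
      rw [← hmx] at h
      rwa [hsum]
    · have h := hmem (Fin.append m fun _ => 0) fun τ => by
        refine Fin.addCases (fun τ => ?_) (fun τ => ?_) τ
        · rw [Fin.append_left]
          exact (hm τ).trans hc1
        · rw [Fin.append_right, abs_zero]
          positivity
      rw [Fin.sum_univ_add] at h
      simp only [Fin.append_left, Fin.append_right, Int.cast_zero, zero_mul,
        Finset.sum_const_zero, add_zero] at h
      rwa [hmx]

/-- Matrix relation: after multiplying by suitable row and column matrices `L` and `R`,
most entries of each row (resp. column) of `A' = L·A·R` with index in `I` (resp. `J`)
lie in a proper symmetric GAP of bounded rank and polynomial size. -/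
theorem matrix_relation (ε μ C : ℝ) (hε0 : 0 < ε) (hε1 : ε ≤ 1)
    (hμ0 : 0 < μ) (hμ1 : μ ≤ 1) (hC : 0 < C) :
    ∃ r₀ : ℕ, ∃ c : ℝ, 0 < c ∧ ∃ n₀ : ℕ, ∀ n : ℕ, n₀ ≤ n →
      ∀ A : Matrix (Fin n) (Fin n) ℝ, (n : ℝ) ^ (-C) ≤ rhoBmu μ n A →
        ∃ (I₀ J₀ I J : Finset (Fin n)) (k l : ℤ) (kk ll : Fin n → Fin n → ℤ),
          I₀.card ≤ r₀ ∧ J₀.card ≤ r₀ ∧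
          (n : ℝ) - 3 * (n : ℝ) ^ ε ≤ (I.card : ℝ) ∧
          (n : ℝ) - 3 * (n : ℝ) ^ ε ≤ (J.card : ℝ) ∧
          Disjoint I I₀ ∧ Disjoint J J₀ ∧
          k ≠ 0 ∧ l ≠ 0 ∧ |(k : ℝ)| ≤ (n : ℝ) ^ c ∧ |(l : ℝ)| ≤ (n : ℝ) ^ c ∧
          (∀ i ∈ I, ∀ i₀ ∈ I₀, |(kk i i₀ : ℝ)| ≤ (n : ℝ) ^ c) ∧
          (∀ j ∈ J, ∀ j₀ ∈ J₀, |(ll j₀ j : ℝ)| ≤ (n : ℝ) ^ c) ∧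
          ∃ L R : Matrix (Fin n) (Fin n) ℝ,
            (∀ i j, L i j =
              if i ∈ I then
                (if j = i then (k : ℝ) else if j ∈ I₀ then (kk i j : ℝ) else 0)
              else (if j = i then 1 else 0)) ∧
            (∀ i j, R i j =
              if j ∈ J then
                (if i = j then (l : ℝ) else if i ∈ J₀ then (ll i j : ℝ) else 0)
              else (if i = j then 1 else 0)) ∧
            (∀ i ∈ I, ∃ Q : Set ℝ, IsProperSymGAPSet Q r₀ ((n : ℝ) ^ c) ∧
              ((Finset.univ.filter fun j => (L * A * R) i j ∉ Q).card : ℝ) ≤ (n : ℝ) ^ ε) ∧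
            (∀ j ∈ J, ∃ P : Set ℝ, IsProperSymGAPSet P r₀ ((n : ℝ) ^ c) ∧
              ((Finset.univ.filter fun i => (L * A * R) i j ∉ P).card : ℝ) ≤ (n : ℝ) ^ ε) := by
  obtain ⟨r, c, n₀, hrow⟩ := exists_row_relation (C := C + 1) hε0 hε1 hμ0 hμ1 (by linarith)
  set d : ℕ := ((2 * c + 1) * 2 ^ (r + r) + 1) * (r + r) with hd
  refine ⟨r + r, ((c + d + 1 : ℕ) : ℝ), by positivity, n₀ + 4, fun n hn A h => ?_⟩
  obtain ⟨a, ha⟩ := exists_rpow_neg_le_of_le_rhoBmu (by omega) h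
  obtain ⟨I₀, I, k, kk, hI₀, hI, hII, hk0, hk, hkk, hIrel⟩ := hrow n (by omega) A a ha
  rw [← sum_sum_signWeight_transpose] at ha
  obtain ⟨J₀, J, l, ll, hJ₀, hJ, hJJ, hl0, hl, hll, hJrel⟩ :=
    hrow n (by omega) A.transpose a ha
  have hn1 : (1 : ℝ) ≤ n := by exact_mod_cast (by omega : 1 ≤ n)
  simp only [Real.rpow_natCast]
  have hbound {z : ℤ} (hz : |z| ≤ (n : ℤ) ^ c) : |(z : ℝ)| ≤ (n : ℝ) ^ (c + d + 1) := by
    have h1 : |(z : ℝ)| ≤ (n : ℝ) ^ c := by exact_mod_cast hz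
    exact h1.trans (pow_le_pow_right₀ hn1 (by omega))
  have hgap {Q : Set ℝ} (hQ : IsProperSymGAPSet Q (r + r) ((n : ℝ) ^ d)) :
      IsProperSymGAPSet Q (r + r) ((n : ℝ) ^ (c + d + 1)) := by
    obtain ⟨r', g, N, h1, h2, h3, h4⟩ := hQ
    exact ⟨r', g, N, h1, h2, h3, h4.trans (pow_le_pow_right₀ hn1 (by omega))⟩
  have hcard {F E : Finset (Fin n)} (hE : (E.card : ℝ) ≤ (n : ℝ) ^ ε) (hF : F ⊆ E) :
      (F.card : ℝ) ≤ (n : ℝ) ^ ε :=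
    (Nat.cast_le.2 (Finset.card_le_card hF)).trans hE
  obtain ⟨L, hL⟩ : ∃ L : Matrix (Fin n) (Fin n) ℝ, ∀ i j, L i j = if i ∈ I then
      (if j = i then (k : ℝ) else if j ∈ I₀ then (kk i j : ℝ) else 0)
      else (if j = i then 1 else 0) := ⟨Matrix.of fun i j => _, fun _ _ => rfl⟩
  obtain ⟨R, hR⟩ : ∃ R : Matrix (Fin n) (Fin n) ℝ, ∀ i j, R i j = if j ∈ J then
      (if i = j then (l : ℝ) else if i ∈ J₀ then (ll j i : ℝ) else 0)
      else (if i = j then 1 else 0) := ⟨Matrix.of fun i j => _, fun _ _ => rfl⟩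
  have hLmul := mul_apply_of_row_relation hII (k : ℝ) (fun i i₀ => (kk i i₀ : ℝ)) hL
  have hRmul := mul_apply_of_column_relation hJJ (l : ℝ) (fun j₀ j => (ll j j₀ : ℝ)) hR
  refine ⟨I₀, J₀, I, J, k, l, kk, fun j₀ j => ll j j₀, by omega, by omega, hI, hJ, hII, hJJ,
    hk0, hl0, hbound hk, hbound hl, fun i hi i₀ _ => hbound (hkk i hi i₀),
    fun j hj j₀ _ => hbound (hll j hj j₀), L, R, hL, hR, ?_, ?_⟩
  · intro i hi
    obtain ⟨g, E, hE, hrel⟩ := hIrel i hi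
    obtain ⟨Q, hQ, hmem⟩ := exists_proper_gap_of_relation (by omega)
      (fun j => (k : ℝ) * A i j + ∑ i₀ ∈ I₀, (kk i i₀ : ℝ) * A i₀ j) g E hrel J J₀ hJ₀ l hl ll hll
    refine ⟨Q, hgap hQ, hcard hE fun j hj => ?_⟩
    by_contra hjE
    refine (Finset.mem_filter.1 hj).2 ?_
    rw [hRmul]
    simp only [hLmul, if_pos hi]
    exact hmem j hjE
  · intro j hj
    obtain ⟨g, E, hE, hrel⟩ := hJrel j hj
    obtain ⟨Q, hQ, hmem⟩ := exists_proper_gap_of_relation (by omega)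
      (fun i => (l : ℝ) * A i j + ∑ j₀ ∈ J₀, (ll j j₀ : ℝ) * A i j₀) g E hrel I I₀ hI₀ k hk kk hkk
    refine ⟨Q, hgap hQ, hcard hE fun i hi => ?_⟩
    by_contra hiE
    refine (Finset.mem_filter.1 hi).2 ?_
    rw [Matrix.mul_assoc, hLmul]
    simp only [hRmul, if_pos hj]
    exact hmem i hiE

end
end

section
/- Let 0 < ε < 1, r ≥ 1 an integer and c > 0 be constants. There exist constants s₀ and c' (depending only on r, c and ε) such that the following holds for all sufficiently large n. Let A be an n×n real matrix and let I, J ⊆ {1,…,n} with |I|, |J| ≥ n − 3n^ε. Suppose that for each i ∈ I at least n − n^ε of the entries of the i-th row of A belong to some proper symmetric GAP Q_i of rank at most r and size at most n^c, and for each j ∈ J at least n − n^ε of the entries of the j-th column of A belong to some proper symmetric GAP P_j of rank at most r and size at most n^c. Then there exist an integer s ≤ s₀ and real numbers g₁,…,g_s such that for all but at most εn indices i, all but at most εn entries of the i-th row of A can be written in the form Σ_{h=1}^s (p_h/q_h)·g_h with integers p_h, q_h satisfying q_h ≠ 0 and |p_h|, |q_h| ≤ n^{c'}. -/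
open scoped Classical BigOperators

noncomputable section

/-- A bounded-height form of Cramer's rule: an integer vector in the rational span of a family of
integer vectors is a rational combination of them whose coefficients have height bounded by a
determinant bound. -/
lemma exists_bounded_int_combination {ι : Type*} [Fintype ι] {r : ℕ} (v : ι → Fin r → ℤ)
    (w : Fin r → ℤ) (M : ℤ) (hM : 1 ≤ M) (hv : ∀ i a, |v i a| ≤ M) (hw : ∀ a, |w a| ≤ M)
    (h : (fun a => (w a : ℚ)) ∈ Submodule.span ℚ (Set.range fun i a => (v i a : ℚ))) :
    ∃ (p : ι → ℤ) (q : ℤ), q ≠ 0 ∧ |q| ≤ (r.factorial : ℤ) * M ^ r ∧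
      (∀ i, |p i| ≤ (r.factorial : ℤ) * M ^ r) ∧ ∀ a, q * w a = ∑ i, p i * v i a := by
  set f : ι ⊕ Fin r → Fin r → ℤ := Sum.elim v (fun k => Pi.single k 1) with hf
  set F : ι ⊕ Fin r → Fin r → ℚ := fun x a => (f x a : ℚ) with hF
  have hfM : ∀ x a, |f x a| ≤ M := by
    rintro (i | k) a
    · exact hv i a
    · by_cases hak : a = k
      · subst hak; simpa [hf] using hM
      · simp [hf, hak]; omega
  obtain ⟨b₀, hb₀, -, hs₀, hl₀⟩ := exists_linearIndepOn_extension (K := ℚ) (v := F)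
    (linearIndepOn_empty ℚ F) (Set.empty_subset (Set.range Sum.inl))
  obtain ⟨b₁, -, hb₀₁, hs₁, hl₁⟩ := exists_linearIndepOn_extension (K := ℚ) (v := F)
    hl₀ (Set.subset_union_left (t := Set.range Sum.inr))
  have htop : (⊤ : Submodule ℚ (Fin r → ℚ)) ≤
      Submodule.span ℚ (Set.range fun x : b₁ => F x) := by
    rw [← (Pi.basisFun ℚ (Fin r)).span_eq, Submodule.span_le]
    rintro _ ⟨k, rfl⟩
    have : F (Sum.inr k) ∈ F '' (b₀ ∪ Set.range Sum.inr) := ⟨_, Or.inr ⟨k, rfl⟩, rfl⟩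
    have h2 := hs₁ this
    have h3 : F (Sum.inr k) = Pi.basisFun ℚ (Fin r) k := by
      ext a
      simp [hF, hf, Pi.single_apply]
    rw [h3, Set.image_eq_range] at h2
    exact h2
  have hli : LinearIndependent ℚ (fun x : b₁ => F x) := hl₁
  set B := Module.Basis.mk hli htop with hB
  set e := B.indexEquiv (Pi.basisFun ℚ (Fin r))
  set Bf := B.reindex e with hBf
  have hBfF : ∀ k, Bf k = F (e.symm k) := by
    intro k; rw [hBf, Module.Basis.reindex_apply, hB, Module.Basis.mk_apply]
  set A : Matrix (Fin r) (Fin r) ℤ := Matrix.of fun a k => f (e.symm k) a with hA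
  have hdet : A.det ≠ 0 := by
    have h1 : LinearIndependent ℚ (A.map (Int.castRingHom ℚ)).col := by
      have h2 : (A.map (Int.castRingHom ℚ)).col = Bf := by
        ext k a
        rw [hBfF]
        simp [hA, hF, Matrix.col]
      rw [h2]
      exact Bf.linearIndependent
    rw [Matrix.linearIndependent_cols_iff_isUnit, Matrix.isUnit_iff_isUnit_det] at h1
    have h3 := h1.ne_zero
    rw [← RingHom.mapMatrix_apply, ← RingHom.map_det] at h3
    intro h4
    simp [h4] at h3
  have hdetle : ∀ C : Matrix (Fin r) (Fin r) ℤ, (∀ a k, |C a k| ≤ M) →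
      |C.det| ≤ (r.factorial : ℤ) * M ^ r := by
    intro C hC
    simpa using Matrix.det_le (abv := AbsoluteValue.abs) (x := M) hC
  have hcr : ∀ a, ∑ k, A.cramer w k * f (e.symm k) a = A.det * w a := by
    intro a
    have := congrFun (Matrix.mulVec_cramer A w) a
    simp only [Matrix.mulVec, dotProduct, Pi.smul_apply, smul_eq_mul] at this
    rw [← this]
    exact Finset.sum_congr rfl fun k _ => by simp [hA, mul_comm]
  have hcrle : ∀ k, |A.cramer w k| ≤ (r.factorial : ℤ) * M ^ r := by
    intro k
    rw [Matrix.cramer_apply]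
    refine hdetle _ fun a l => ?_
    rw [Matrix.updateCol_apply]
    split_ifs
    · exact hw a
    · exact hfM _ _
  have hrepr : ∀ k, Bf.repr (fun a => (w a : ℚ)) k = (A.cramer w k : ℚ) / A.det := by
    have : (fun a => (w a : ℚ)) = ∑ k, ((A.cramer w k : ℚ) / A.det) • Bf k := by
      ext a
      have h1 := hcr a
      have h2 : (A.det : ℚ) ≠ 0 := by exact_mod_cast hdet
      have h3 : (∑ k, (A.cramer w k : ℚ) * f (e.symm k) a) = A.det * w a := by exact_mod_cast h1
      simp only [Finset.sum_apply, Pi.smul_apply, hBfF, smul_eq_mul, hF, div_mul_eq_mul_div]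
      rw [← Finset.sum_div, h3]
      field_simp
    intro k
    rw [this, Bf.repr_sum_self]
  have hzero : ∀ k, (e.symm k : ι ⊕ Fin r) ∉ b₀ → A.cramer w k = 0 := by
    intro k hk
    have hwb : (fun a => (w a : ℚ)) ∈ Submodule.span ℚ (Bf '' {k | (e.symm k : ι ⊕ Fin r) ∈ b₀}) := by
      have himg : Bf '' {k | (e.symm k : ι ⊕ Fin r) ∈ b₀} = F '' b₀ := by
        ext y
        constructor
        · rintro ⟨k, hk, rfl⟩
          exact ⟨_, hk, (hBfF k).symm⟩
        · rintro ⟨x, hx, rfl⟩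
          refine ⟨e ⟨x, hb₀₁ hx⟩, ?_, ?_⟩
          · simpa using hx
          · rw [hBfF]; simp
      rw [himg]
      refine Submodule.span_le.2 ?_ h
      rintro _ ⟨i, rfl⟩
      exact hs₀ ⟨Sum.inl i, ⟨i, rfl⟩, rfl⟩
    rw [Bf.mem_span_image] at hwb
    by_contra hne
    refine hk (hwb ?_)
    rw [Finset.mem_coe, Finsupp.mem_support_iff, hrepr]
    exact div_ne_zero (by exact_mod_cast hne) (by exact_mod_cast hdet)
  set P : ι ⊕ Fin r → ℤ := fun x => if hx : x ∈ b₁ then A.cramer w (e ⟨x, hx⟩) else 0 with hP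
  have hPinr : ∀ k, P (Sum.inr k) = 0 := by
    intro k
    simp only [hP]
    split_ifs with hx
    · refine hzero _ fun hmem => ?_
      obtain ⟨i, hi⟩ := hb₀ hmem
      simp at hi
    · rfl
  refine ⟨fun i => P (Sum.inl i), A.det, hdet, hdetle A fun a k => hfM _ _, fun i => ?_, fun a => ?_⟩
  · simp only [hP]
    split_ifs
    · exact hcrle _
    · rw [abs_zero]; positivity
  · rw [← hcr a]
    have := Fintype.sum_of_injective (fun k => (e.symm k : ι ⊕ Fin r))
      (Subtype.val_injective.comp e.symm.injective)
      (fun k => A.cramer w k * f (e.symm k) a) (fun x => P x * f x a)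
      (fun x hx => by
        have : x ∉ b₁ := fun hxb => hx ⟨e ⟨x, hxb⟩, by simp⟩
        simp [hP, this])
      (fun k => by simp [hP])
    rw [this, Fintype.sum_sum_type]
    simp [hPinr, hf]

/-- Greedy selection: given vectors `V i j` in `ℚ ^ r`, a bounded number of rows `i ∈ S` suffices
for every row of `I` to lie, in all but few columns, in the span of the selected ones. -/
lemma exists_finset_forall_card_notMem_span_le {α β : Type*} [Fintype β] {r : ℕ}
    (V : α → β → Fin r → ℚ) (I : Finset α) (T : ℝ) (hT : 0 ≤ T) :
    ∃ S ⊆ I, (S.card : ℝ) * T ≤ r * Fintype.card β ∧ ∀ i ∈ I,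
      ((Finset.univ.filter fun j =>
        V i j ∉ Submodule.span ℚ (Set.range fun i' : S => V i' j)).card : ℝ) ≤ T := by
  set W : Finset α → β → Submodule ℚ (Fin r → ℚ) :=
    fun S j => Submodule.span ℚ (Set.range fun i' : S => V i' j) with hW
  set D : Finset α → ℕ := fun S => ∑ j, Module.finrank ℚ (W S j) with hD
  obtain ⟨S, hSI, hmax⟩ := Finset.exists_max_image I.powerset
    (fun S => (D S : ℝ) - S.card * T) ⟨∅, Finset.empty_mem_powerset I⟩
  rw [Finset.mem_powerset] at hSI
  have hDle : D S ≤ r * Fintype.card β := by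
    calc D S ≤ ∑ _j : β, r := Finset.sum_le_sum fun j _ => by
          simpa using Submodule.finrank_le (W S j)
      _ = r * Fintype.card β := by simp [mul_comm]
  have hDle' : (D S : ℝ) ≤ r * Fintype.card β := by exact_mod_cast hDle
  refine ⟨S, hSI, ?_, fun i hi => ?_⟩
  · have h := hmax ∅ (Finset.empty_mem_powerset I)
    simp only [Finset.card_empty, Nat.cast_zero, zero_mul, sub_zero] at h
    have : (0 : ℝ) ≤ D ∅ := by positivity
    linarith
  · have h := hmax (insert i S) (Finset.mem_powerset.2 (Finset.insert_subset hi hSI))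
    have hc : ((insert i S).card : ℝ) ≤ S.card + 1 := by
      exact_mod_cast Finset.card_insert_le i S
    have hmono : ∀ j, W S j ≤ W (insert i S) j := fun j => by
      refine Submodule.span_mono ?_
      rintro _ ⟨⟨i', hi'⟩, rfl⟩
      exact ⟨⟨i', Finset.mem_insert_of_mem hi'⟩, rfl⟩
    have hinc : (Finset.univ.filter fun j => V i j ∉ W S j).card + D S ≤ D (insert i S) := by
      simp only [hD]
      rw [Finset.card_filter, ← Finset.sum_add_distrib]
      refine Finset.sum_le_sum fun j _ => ?_
      by_cases hj : V i j ∈ W S j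
      · simpa [hj] using Submodule.finrank_mono (hmono j)
      · have : W S j < W (insert i S) j := by
          refine lt_of_le_of_ne (hmono j) fun heq => hj ?_
          have hmem : V i j ∈ W (insert i S) j :=
            Submodule.subset_span ⟨⟨i, Finset.mem_insert_self i S⟩, rfl⟩
          rwa [← heq] at hmem
        have := Submodule.finrank_lt_finrank_of_lt this
        simp only [hj, not_false_eq_true, if_true]
        omega
    have hinc' : ((Finset.univ.filter fun j => V i j ∉ W S j).card : ℝ) + D S
        ≤ D (insert i S) := by exact_mod_cast hinc
    nlinarith

/-- Elements of a symmetric GAP have bounded integer coordinates, padded to the maximal rank. -/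
lemma IsProperSymGAPSet.exists_coords {Q : Set ℝ} {r : ℕ} {s : ℝ} (hQ : IsProperSymGAPSet Q r s) :
    ∃ g : Fin r → ℝ, ∀ x ∈ Q, ∃ m : Fin r → ℤ,
      (∀ h, |(m h : ℝ)| ≤ s) ∧ x = ∑ h, (m h : ℝ) * g h := by
  obtain ⟨d, g, N, hd, rfl, -, hs⟩ := hQ
  have hinj := Fin.castLE_injective hd
  have hs1 : 1 ≤ s := le_trans (Finset.one_le_prod fun i => by
    simp) hs
  refine ⟨Function.extend (Fin.castLE hd) g 0, ?_⟩
  rintro x ⟨m, hm, rfl⟩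
  refine ⟨Function.extend (Fin.castLE hd) m 0, fun h => ?_, ?_⟩
  · by_cases hh : ∃ k, Fin.castLE hd k = h
    · obtain ⟨k, rfl⟩ := hh
      rw [hinj.extend_apply]
      have h1 : |(m k : ℝ)| ≤ N k := by exact_mod_cast hm k
      have h2 : (2 * (N k : ℝ) + 1) ≤ ∏ i, (2 * (N i : ℝ) + 1) := by
        rw [← Finset.mul_prod_erase _ _ (Finset.mem_univ k)]
        refine le_mul_of_one_le_right (by positivity) (Finset.one_le_prod fun i => ?_)
        simp
      have : (0 : ℝ) ≤ N k := by positivity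
      linarith
    · rw [Function.extend_apply' _ _ _ hh]
      simp; linarith
  · refine Fintype.sum_of_injective _ hinj _ _ (fun i hi => ?_) (fun i => ?_)
    · rw [Function.extend_apply' _ _ _ hi]; simp
    · rw [hinj.extend_apply, hinj.extend_apply]

/-- A family of reals lying mostly in a GAP is given by bounded integer coordinates outside a small
exceptional set, on which the coordinates are set to zero. -/
lemma exists_coords_off_exceptional {ι : Type*} [Fintype ι] (x : ι → ℝ) {r : ℕ} {s b : ℝ}
    (hs : 0 ≤ s) (p : Prop) (h : p → ∃ Q : Set ℝ, IsProperSymGAPSet Q r s ∧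
      ((Finset.univ.filter fun i => x i ∉ Q).card : ℝ) ≤ b) :
    ∃ (g : Fin r → ℝ) (m : ι → Fin r → ℤ) (B : Finset ι),
      (∀ i k, |(m i k : ℝ)| ≤ s) ∧ (∀ i ∉ B, x i = ∑ k, (m i k : ℝ) * g k) ∧
      (∀ i ∈ B, m i = 0) ∧ (p → (B.card : ℝ) ≤ b) := by
  by_cases hp : p
  · obtain ⟨Q, hQ, hb⟩ := h hp
    obtain ⟨g, hg⟩ := hQ.exists_coords
    choose! m hm hx using hg
    refine ⟨g, fun i => if x i ∈ Q then m (x i) else 0, Finset.univ.filter fun i => x i ∉ Q,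
      fun i k => ?_, fun i hi => ?_, fun i hi => ?_, fun _ => hb⟩
    · dsimp only
      split_ifs with hi
      · exact hm _ hi k
      · simpa using hs
    · have hi' : x i ∈ Q := by simpa using hi
      simpa [hi'] using hx _ hi'
    · have hi' : x i ∉ Q := by simpa using hi
      simp [hi']
  · exact ⟨0, 0, Finset.univ, fun i k => by simpa using hs, by simp, by simp, fun h => absurd h hp⟩

/-- A sublinear power is eventually smaller than any constant fraction of `n`. -/
lemma eventually_mul_rpow_le {ε : ℝ} (hε : ε < 1) (C : ℝ) :
    ∀ᶠ n : ℕ in Filter.atTop, C * (n : ℝ) ^ ε ≤ n := by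
  have h1 : Filter.Tendsto (fun n : ℕ => (n : ℝ) ^ (1 - ε)) Filter.atTop Filter.atTop :=
    (tendsto_rpow_atTop (by linarith)).comp tendsto_natCast_atTop_atTop
  filter_upwards [h1.eventually_ge_atTop C, Filter.eventually_gt_atTop 0] with n hn h0
  have h0' : (0 : ℝ) < n := by exact_mod_cast h0
  calc C * (n : ℝ) ^ ε ≤ (n : ℝ) ^ (1 - ε) * (n : ℝ) ^ ε := by gcongr
    _ = n := by rw [← Real.rpow_add h0']; simp

/-- Rational representation of an entry through the row generators of finitely many rows, when the
column coordinates of the entry lie in the span of those of the selected rows. -/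
lemma exists_common_representation {ι : Type*} [Fintype ι] {r : ℕ} {R : ℝ} (hR : 1 ≤ R)
    (v : ι → Fin r → ℤ) (w : Fin r → ℤ) (γ : Fin r → ℝ) (x : ι → ℝ) (m : ι → Fin r → ℤ)
    (g : ι → Fin r → ℝ) (hv : ∀ i a, |(v i a : ℝ)| ≤ R) (hw : ∀ a, |(w a : ℝ)| ≤ R)
    (hm : ∀ i a, |(m i a : ℝ)| ≤ R)
    (hvx : ∀ i, v i = 0 ∨ x i = ∑ a, (v i a : ℝ) * γ a)
    (hmx : ∀ i, x i = ∑ a, (m i a : ℝ) * g i a)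
    (h : (fun a => (w a : ℚ)) ∈ Submodule.span ℚ (Set.range fun i a => (v i a : ℚ))) :
    ∃ (p : ι → Fin r → ℤ) (q : ℤ), q ≠ 0 ∧ |(q : ℝ)| ≤ r.factorial * R ^ (r + 1) ∧
      (∀ i a, |(p i a : ℝ)| ≤ r.factorial * R ^ (r + 1)) ∧
      ∑ a, (w a : ℝ) * γ a = ∑ i, ∑ a, ((p i a : ℝ) / q) * g i a := by
  have hfl : ∀ z : ℤ, |(z : ℝ)| ≤ R → |z| ≤ ⌊R⌋ := fun z hz =>
    Int.le_floor.2 (by push_cast; exact hz)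
  have hM : (1 : ℤ) ≤ ⌊R⌋ := Int.le_floor.2 (by simpa using hR)
  obtain ⟨p, q, hq, hqM, hpM, hpq⟩ := exists_bounded_int_combination v w ⌊R⌋ hM
    (fun i a => hfl _ (hv i a)) (fun a => hfl _ (hw a)) h
  have hbound : ∀ z : ℤ, |z| ≤ (r.factorial : ℤ) * ⌊R⌋ ^ r → |(z : ℝ)| ≤ r.factorial * R ^ r := by
    intro z hz
    have h1 : |(z : ℝ)| ≤ (r.factorial : ℝ) * (⌊R⌋ : ℝ) ^ r := by exact_mod_cast hz
    have h2 : (0 : ℝ) ≤ (⌊R⌋ : ℝ) := by exact_mod_cast (by omega : (0 : ℤ) ≤ ⌊R⌋)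
    refine h1.trans ?_
    gcongr
    exact Int.floor_le R
  have hq' : (q : ℝ) ≠ 0 := by exact_mod_cast hq
  refine ⟨fun i a => if v i = 0 then 0 else p i * m i a, q, hq, ?_, fun i a => ?_, ?_⟩
  · refine (hbound q hqM).trans ?_
    gcongr
    omega
  · dsimp only
    split_ifs
    · rw [Int.cast_zero, abs_zero]; positivity
    · rw [Int.cast_mul, abs_mul, pow_succ, ← mul_assoc]
      exact mul_le_mul (hbound _ (hpM i)) (hm i a) (abs_nonneg _) (by positivity)
  · have h1 : ∀ a, (q : ℝ) * w a = ∑ i, (p i : ℝ) * v i a := fun a => by exact_mod_cast hpq a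
    have h2 : (q : ℝ) * ∑ a, (w a : ℝ) * γ a = ∑ i, (p i : ℝ) * ∑ a, (v i a : ℝ) * γ a := by
      simp_rw [Finset.mul_sum]
      rw [Finset.sum_comm]
      refine Finset.sum_congr rfl fun a _ => ?_
      rw [← mul_assoc, h1, Finset.sum_mul]
      exact Finset.sum_congr rfl fun i _ => by ring
    rw [eq_div_of_mul_eq hq' ((mul_comm _ _).trans h2), Finset.sum_div]
    refine Finset.sum_congr rfl fun i _ => ?_
    by_cases hi : v i = 0
    · simp [hi]
    · rw [← (hvx i).resolve_left hi, hmx i, Finset.mul_sum, Finset.sum_div]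
      refine Finset.sum_congr rfl fun a _ => ?_
      simp only [if_neg hi]
      push_cast
      ring

/-- Unification of the row and column GAPs into a common structure: if most entries of most
rows and columns of `A` lie in proper symmetric GAPs of bounded rank and polynomial size,
then there are boundedly many common generators `g₁, …, g_s` such that for all but `εn`
rows, all but `εn` entries of the row can be written as `Σ (p_h/q_h)·g_h` with polynomially
bounded integers `p_h, q_h`. -/
theorem common_GAP_unification (ε : ℝ) (r : ℕ) (c : ℝ)
    (hε0 : 0 < ε) (hε1 : ε < 1) (hr : 1 ≤ r) (hc : 0 < c) :
    ∃ s₀ : ℕ, ∃ c' : ℝ, 0 < c' ∧ ∃ n₀ : ℕ, ∀ n : ℕ, n₀ ≤ n →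
      ∀ A : Matrix (Fin n) (Fin n) ℝ, ∀ I J : Finset (Fin n),
        (n : ℝ) - 3 * (n : ℝ) ^ ε ≤ (I.card : ℝ) →
        (n : ℝ) - 3 * (n : ℝ) ^ ε ≤ (J.card : ℝ) →
        (∀ i ∈ I, ∃ Q : Set ℝ, IsProperSymGAPSet Q r ((n : ℝ) ^ c) ∧
          ((Finset.univ.filter fun j => A i j ∉ Q).card : ℝ) ≤ (n : ℝ) ^ ε) →
        (∀ j ∈ J, ∃ P : Set ℝ, IsProperSymGAPSet P r ((n : ℝ) ^ c) ∧
          ((Finset.univ.filter fun i => A i j ∉ P).card : ℝ) ≤ (n : ℝ) ^ ε) →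
        ∃ (s : ℕ) (g : Fin s → ℝ),
          s ≤ s₀ ∧
          ((Finset.univ.filter fun i : Fin n =>
            ¬ (((Finset.univ.filter fun j : Fin n =>
                ¬ ∃ p q : Fin s → ℤ,
                  (∀ h, q h ≠ 0 ∧ |(p h : ℝ)| ≤ (n : ℝ) ^ c' ∧ |(q h : ℝ)| ≤ (n : ℝ) ^ c') ∧
                  A i j = ∑ h, ((p h : ℝ) / (q h : ℝ)) * g h).card : ℝ) ≤ ε * n)).card : ℝ)
            ≤ ε * n := by
  set K : ℕ := ⌈4 * r / ε⌉₊
  have hev := ((eventually_mul_rpow_le hε1 (2 * (3 + K) / ε)).and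
    (eventually_mul_rpow_le hε1 ((3 + 4 / ε) / ε))).and
    ((Filter.eventually_ge_atTop r.factorial).and (Filter.eventually_gt_atTop 0))
  obtain ⟨n₀, hn₀⟩ := Filter.eventually_atTop.1 hev
  refine ⟨K * r, c * (r + 1) + 1, by positivity, n₀, ?_⟩
  intro n hn A I J hI hJ hQ hP
  obtain ⟨⟨hbig₁, hbig₂⟩, hfact, hpos⟩ := hn₀ n hn
  have hn0 : (0 : ℝ) < n := by exact_mod_cast hpos
  have hn1 : (1 : ℝ) ≤ n := by exact_mod_cast hpos
  have hR : 1 ≤ (n : ℝ) ^ c := Real.one_le_rpow hn1 hc.le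
  have hbig₁' : (3 + K) * (n : ℝ) ^ ε ≤ ε * n / 2 := by
    have : (3 + K) * (n : ℝ) ^ ε = ε / 2 * (2 * (3 + K) / ε * (n : ℝ) ^ ε) := by field_simp
    rw [this]; nlinarith
  have hbig₂' : (3 + 4 / ε) * (n : ℝ) ^ ε ≤ ε * n := by
    have : (3 + 4 / ε) * (n : ℝ) ^ ε = ε * ((3 + 4 / ε) / ε * (n : ℝ) ^ ε) := by field_simp
    rw [this]; gcongr
  have hQ' := fun i => exists_coords_off_exceptional (fun j => A i j) (zero_le_one.trans hR)
    (i ∈ I) (hQ i)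
  have hP' := fun j => exists_coords_off_exceptional (fun i => A i j) (zero_le_one.trans hR)
    (j ∈ J) (hP j)
  choose g m BQ hm hmA _ hBQ using hQ'
  choose γ V BP hV hVA hV0 hBP using hP'
  obtain ⟨S, hSI, hScard, hS⟩ := exists_finset_forall_card_notMem_span_le
    (fun i j a => (V j i a : ℚ)) I (ε * n / 4) (by positivity)
  have hSK : (S.card : ℝ) ≤ K := by
    refine le_trans ?_ (Nat.le_ceil _)
    rw [le_div_iff₀ hε0]
    rw [Fintype.card_fin] at hScard
    nlinarith
  set e := Fintype.equivFin (S × Fin r)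
  have hheight : r.factorial * ((n : ℝ) ^ c) ^ (r + 1) ≤ (n : ℝ) ^ (c * (r + 1) + 1) := by
    have h1 : (r.factorial : ℝ) ≤ n := by exact_mod_cast hfact
    have h2 : ((n : ℝ) ^ c) ^ (r + 1) = (n : ℝ) ^ (c * (r + 1)) := by
      rw [← Real.rpow_natCast, ← Real.rpow_mul hn0.le]; push_cast; rfl
    rw [h2, Real.rpow_add hn0, Real.rpow_one, mul_comm]
    gcongr
  refine ⟨Fintype.card (S × Fin r), fun h => g (e.symm h).1 (e.symm h).2, ?_, ?_⟩
  · rw [Fintype.card_prod, Fintype.card_coe, Fintype.card_fin]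
    exact Nat.mul_le_mul_right r (by exact_mod_cast hSK)
  set good : Fin n → Fin n → Prop := fun i j =>
    ∃ p q : Fin (Fintype.card (S × Fin r)) → ℤ,
      (∀ h, q h ≠ 0 ∧ |(p h : ℝ)| ≤ (n : ℝ) ^ (c * (r + 1) + 1) ∧
        |(q h : ℝ)| ≤ (n : ℝ) ^ (c * (r + 1) + 1)) ∧
      A i j = ∑ h, ((p h : ℝ) / (q h : ℝ)) * g (e.symm h).1 (e.symm h).2 with hgood
  have hrep : ∀ i j, i ∉ BP j → (fun a => (V j i a : ℚ)) ∈ Submodule.span ℚ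
      (Set.range fun (i' : S) a => (V j i' a : ℚ)) → (∀ i' ∈ S, j ∉ BQ i') → good i j := by
    intro i j hi hspan hj
    obtain ⟨p, q, hq, hqM, hpM, heq⟩ := exists_common_representation hR (fun i' : S => V j i')
      (V j i) (γ j) (fun i' : S => A i' j) (fun i' : S => m i' j) (fun i' : S => g i')
      (fun i' a => hV j i' a) (fun a => hV j i a) (fun i' a => hm i' j a)
      (fun i' => (em ((i' : Fin n) ∈ BP j)).imp (hV0 j i') (hVA j i'))
      (fun i' => hmA i' j (hj i' i'.2)) hspan
    refine ⟨fun h => p (e.symm h).1 (e.symm h).2, fun _ => q,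
      fun h => ⟨hq, (hpM _ _).trans hheight, hqM.trans hheight⟩, ?_⟩
    rw [hVA j i hi, heq,
      e.symm.sum_comp (fun y : S × Fin r => ((p y.1 y.2 : ℝ) / q) * g y.1 y.2),
      Fintype.sum_prod_type]
  have hcompl : ∀ L : Finset (Fin n), (n : ℝ) - 3 * (n : ℝ) ^ ε ≤ L.card →
      ((Lᶜ).card : ℝ) ≤ 3 * (n : ℝ) ^ ε := by
    intro L hL
    rw [Finset.card_compl, Nat.cast_sub (Finset.card_le_univ L), Fintype.card_fin]
    linarith
  set E : Fin n → Finset (Fin n) := fun i => J.filter fun j => i ∈ BP j with hE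
  have hEsum : ∑ i, ((E i).card : ℝ) ≤ n * (n : ℝ) ^ ε := by
    have h1 : ∑ i, (E i).card = ∑ j ∈ J, (BP j).card := by
      have := Finset.sum_card_bipartiteAbove_eq_sum_card_bipartiteBelow
        (fun (i j : Fin n) => i ∈ BP j) (s := Finset.univ) (t := J)
      simpa [Finset.bipartiteAbove, Finset.bipartiteBelow, hE] using this
    have h2 : ∑ i, ((E i).card : ℝ) = ∑ j ∈ J, ((BP j).card : ℝ) := by exact_mod_cast h1
    have h3 : (J.card : ℝ) ≤ n := by
      exact_mod_cast (Finset.card_le_univ J).trans_eq (Fintype.card_fin n)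
    calc ∑ i, ((E i).card : ℝ) = ∑ j ∈ J, ((BP j).card : ℝ) := h2
      _ ≤ ∑ _j ∈ J, (n : ℝ) ^ ε := Finset.sum_le_sum fun j hj => hBP j hj
      _ = J.card * (n : ℝ) ^ ε := by simp
      _ ≤ n * (n : ℝ) ^ ε := by gcongr
  set H : Finset (Fin n) := Finset.univ.filter fun i => ε * n / 4 < (E i).card with hH
  have hHcard : (H.card : ℝ) ≤ 4 / ε * (n : ℝ) ^ ε := by
    have h1 : H.card * (ε * n / 4) ≤ n * (n : ℝ) ^ ε := by
      calc H.card * (ε * n / 4) = ∑ _i ∈ H, ε * n / 4 := by simp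
        _ ≤ ∑ i ∈ H, ((E i).card : ℝ) :=
          Finset.sum_le_sum fun i hi => (Finset.mem_filter.1 hi).2.le
        _ ≤ ∑ i, ((E i).card : ℝ) :=
          Finset.sum_le_sum_of_subset_of_nonneg (Finset.subset_univ _) fun _ _ _ => by positivity
        _ ≤ _ := hEsum
    rw [div_mul_eq_mul_div, le_div_iff₀ hε0]
    have h2 : n * (H.card * ε) ≤ n * (4 * (n : ℝ) ^ ε) := by linarith
    exact le_of_mul_le_mul_left h2 hn0
  have hrow : ∀ i, i ∉ Iᶜ ∪ H →
      ((Finset.univ.filter fun j => ¬ good i j).card : ℝ) ≤ ε * n := by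
    intro i hi
    rw [Finset.mem_union, Finset.mem_compl, not_or, not_not] at hi
    obtain ⟨hiI, hiH⟩ := hi
    have hEi : ((E i).card : ℝ) ≤ ε * n / 4 := by simpa [hH] using hiH
    set N := Finset.univ.filter fun j => (fun a => (V j i a : ℚ)) ∉ Submodule.span ℚ
      (Set.range fun (i' : S) a => (V j i' a : ℚ)) with hN
    have hsub : (Finset.univ.filter fun j => ¬ good i j) ⊆ Jᶜ ∪ E i ∪ N ∪ S.biUnion BQ := by
      intro j hj
      by_contra hnot
      simp only [Finset.mem_union, Finset.mem_compl, not_or, not_not, hE, hN, Finset.mem_filter,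
        Finset.mem_univ, true_and, Finset.mem_biUnion, not_exists, not_and] at hnot hj
      exact hj (hrep i j (hnot.1.1.2 hnot.1.1.1) hnot.1.2 hnot.2)
    have hU : ((S.biUnion BQ).card : ℝ) ≤ K * (n : ℝ) ^ ε := by
      calc ((S.biUnion BQ).card : ℝ) ≤ ∑ i ∈ S, ((BQ i).card : ℝ) := by
            exact_mod_cast Finset.card_biUnion_le
        _ ≤ ∑ _i ∈ S, (n : ℝ) ^ ε := Finset.sum_le_sum fun i hi => hBQ i (hSI hi)
        _ = S.card * (n : ℝ) ^ ε := by simp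
        _ ≤ K * (n : ℝ) ^ ε := by gcongr
    have hcard : ((Finset.univ.filter fun j => ¬ good i j).card : ℝ) ≤
        (Jᶜ).card + (E i).card + N.card + (S.biUnion BQ).card := by
      have h1 := Finset.card_le_card hsub
      have h2 := Finset.card_union_le (Jᶜ ∪ E i ∪ N) (S.biUnion BQ)
      have h3 := Finset.card_union_le (Jᶜ ∪ E i) N
      have h4 := Finset.card_union_le Jᶜ (E i)
      exact_mod_cast (by omega : (Finset.univ.filter fun j => ¬ good i j).card ≤
        (Jᶜ).card + (E i).card + N.card + (S.biUnion BQ).card)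
    have hNi : (N.card : ℝ) ≤ ε * n / 4 := hS i hiI
    have hJc := hcompl J hJ
    linarith
  have hsub : (Finset.univ.filter fun i : Fin n =>
      ¬ (((Finset.univ.filter fun j : Fin n => ¬ good i j).card : ℝ) ≤ ε * n)) ⊆ Iᶜ ∪ H := by
    intro i hi
    by_contra hnot
    exact (Finset.mem_filter.1 hi).2 (hrow i hnot)
  have h1 : ((Finset.univ.filter fun i : Fin n =>
      ¬ (((Finset.univ.filter fun j : Fin n => ¬ good i j).card : ℝ) ≤ ε * n)).card : ℝ) ≤
      (Iᶜ).card + H.card := by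
    exact_mod_cast (Finset.card_le_card hsub).trans (Finset.card_union_le _ _)
  have hIc := hcompl I hI
  linarith

end
end
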